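/- For every odd n ≥ 3, the center of the dynamical Lie algebra ℒ is the two-dimensional real span of C1 := −X + ∑_{k odd, 1 ≤ k ≤ n−2} (Y^k + Z^k) and C2 := XX + ∑_{k even, 0 ≤ k ≤ n−3} (Y^k + Z^k). -/

import Mathlib

namespace Ising

noncomputable section

open Matrix

attribute [local instance 100] LieRing.ofAssociativeRing

/-- We model `2^n × 2^n` complex matrices as matrices indexed by `Fin n → Fin 2`
(the standard index type for an `n`-fold tensor product of qubits). -/
abbrev M (n : ℕ) := Matrix (Fin n → Fin 2) (Fin n → Fin 2) ℂ

/-- The Pauli matrix σx. -/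
def sx : Matrix (Fin 2) (Fin 2) ℂ := !![0, 1; 1, 0]
/-- The Pauli matrix σy. -/
def sy : Matrix (Fin 2) (Fin 2) ℂ := !![0, Complex.I; -Complex.I, 0]
/-- The Pauli matrix σz. -/
def sz : Matrix (Fin 2) (Fin 2) ℂ := !![1, 0; 0, -1]

/-- The `n`-fold Kronecker product of the `2 × 2` matrices `f 0, …, f (n-1)`. -/
def kron {n : ℕ} (f : Fin n → Matrix (Fin 2) (Fin 2) ℂ) : M n :=
  fun x y => ∏ j, f j (x j) (y j)

/-- The matrix `σ` placed in the `j`-th tensor factor, identity elsewhere (`σ^j`). -/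
def pauliAt (n : ℕ) (σ : Matrix (Fin 2) (Fin 2) ℂ) (j : Fin n) : M n :=
  kron fun i => if i = j then σ else 1

/-- The permutation matrix implementing the cyclic shift of the `n` tensor factors. -/
def P (n : ℕ) : M n :=
  fun x y => if x = (fun i => y (finRotate n i)) then 1 else 0

/-- The symmetrizer `C(A) = ∑_{k=0}^{n-1} Pᵏ A (Pᵏ)⁻¹` over the cyclic group `C_n`. -/
def symmC {n : ℕ} (A : M n) : M n :=
  ∑ k ∈ Finset.range n, P n ^ k * A * (P n ^ k)⁻¹

/-- The Pauli string `a ⊗ σx^{⊗j} ⊗ b ⊗ 1^{⊗(n-j-2)}`. -/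
def str (n : ℕ) (a b : Matrix (Fin 2) (Fin 2) ℂ) (j : ℕ) : M n :=
  kron fun i => if (i : ℕ) = 0 then a else if (i : ℕ) = j + 1 then b
    else if (i : ℕ) ≤ j then sx else 1

/-- `Y^j := i C(σy ⊗ σx^{⊗j} ⊗ σy ⊗ 1^{⊗(n-j-2)})`. -/
def Y (n j : ℕ) : M n := Complex.I • symmC (str n sy sy j)
/-- `Z^j := i C(σz ⊗ σx^{⊗j} ⊗ σz ⊗ 1^{⊗(n-j-2)})`. -/
def Z (n j : ℕ) : M n := Complex.I • symmC (str n sz sz j)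
/-- `YZ^j := i C(σz ⊗ σx^{⊗j} ⊗ σy ⊗ 1^{⊗(n-j-2)}) + i C(σy ⊗ σx^{⊗j} ⊗ σz ⊗ 1^{⊗(n-j-2)})`. -/
def YZ (n j : ℕ) : M n :=
  Complex.I • symmC (str n sz sy j) + Complex.I • symmC (str n sy sz j)
/-- `X := i C(σx ⊗ 1^{⊗(n-1)})`. -/
def X (n : ℕ) : M n :=
  Complex.I • symmC (kron fun i : Fin n => if (i : ℕ) = 0 then sx else 1)
/-- `XX := i C(σx^{⊗(n-1)} ⊗ 1)`. -/
def XX (n : ℕ) : M n :=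
  Complex.I • symmC (kron fun i : Fin n => if (i : ℕ) = n - 1 then 1 else sx)

/-- `H0 = ∑_{j=1}^{n-1} σz^j σz^{j+1} + σz^n σz^1` (cyclically next neighbours). -/
def H0 (n : ℕ) : M n := ∑ j : Fin n, pauliAt n sz j * pauliAt n sz (finRotate n j)
/-- `H1 = ∑_{j=1}^{n} σx^j`. -/
def H1 (n : ℕ) : M n := ∑ j : Fin n, pauliAt n sx j

/-- The dynamical Lie algebra: the smallest real Lie subalgebra of the `2^n × 2^n`
complex matrices (with the commutator bracket) containing `i•H0` and `i•H1`. -/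
def DLA (n : ℕ) : LieSubalgebra ℝ (M n) :=
  LieSubalgebra.lieSpan ℝ (M n) {Complex.I • H0 n, Complex.I • H1 n}

/-- `C1 := -X + ∑_{k odd, 1 ≤ k ≤ n-2} (Y^k + Z^k)` (for odd `n`). -/
def C1odd (n : ℕ) : M n :=
  -X n + ∑ k ∈ Finset.range (n - 1), if Odd k then Y n k + Z n k else 0

/-- `C2 := XX + ∑_{k even, 0 ≤ k ≤ n-3} (Y^k + Z^k)` (for odd `n`). -/
def C2odd (n : ℕ) : M n :=
  XX n + ∑ k ∈ Finset.range (n - 1), if Even k then Y n k + Z n k else 0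

/-! ### Sites and elementary Pauli operators -/

/-- reduction of an integer position modulo `n` -/
def site (n : ℕ) [NeZero n] (j : ℤ) : Fin n :=
  ⟨(j % n).toNat, by
    have h0 : (0 : ℤ) < n := by exact_mod_cast Nat.pos_of_ne_zero (NeZero.ne n)
    have h1 := Int.emod_nonneg j h0.ne'
    have h2 := Int.emod_lt_of_pos j h0
    omega⟩

section
set_option linter.unusedSectionVars false
variable {n : ℕ} [NeZero n]

lemma npos : (0 : ℤ) < n := by exact_mod_cast Nat.pos_of_ne_zero (NeZero.ne n)

lemma site_val (j : ℤ) : ((site n j : ℕ) : ℤ) = j % n := by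
  have h1 := Int.emod_nonneg j (npos (n := n)).ne'
  simp only [site]
  omega

lemma site_eq_iff (j k : ℤ) : site n j = site n k ↔ (n : ℤ) ∣ j - k := by
  rw [Fin.ext_iff, ← Int.natCast_inj, site_val, site_val, Int.emod_eq_emod_iff_emod_sub_eq_zero]
  exact ⟨Int.dvd_of_emod_eq_zero, Int.emod_eq_zero_of_dvd⟩

lemma site_coe (i : Fin n) : site n ((i : ℕ) : ℤ) = i := by
  rw [Fin.ext_iff, ← Int.natCast_inj, site_val]
  exact Int.emod_eq_of_lt (by positivity) (by exact_mod_cast i.2)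

lemma site_add_n (j : ℤ) : site n (j + n) = site n j := by
  rw [site_eq_iff]; simp

lemma rot_site (j : ℤ) : finRotate n (site n j) = site n (j + 1) := by
  obtain ⟨p, rfl⟩ : ∃ p, n = p + 1 := ⟨n - 1, by have := NeZero.ne n; omega⟩
  have h0 : (0 : ℤ) < (p + 1 : ℕ) := npos
  have h1 := Int.emod_nonneg j h0.ne'
  have h2 := Int.emod_lt_of_pos j h0
  have hv := site_val (n := p + 1) j
  have hv' := site_val (n := p + 1) (j + 1)
  rw [Fin.ext_iff, coe_finRotate]
  have key : (j + 1) % ((p + 1 : ℕ) : ℤ) = (j % ((p + 1 : ℕ) : ℤ) + 1) % ((p + 1 : ℕ) : ℤ) := by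
    simp
  split_ifs with h
  · rw [h] at hv
    simp only [Fin.val_last] at hv
    rw [← hv] at key
    have : ((p : ℤ) + 1) % ((p + 1 : ℕ) : ℤ) = 0 := by push_cast; simp
    rw [this] at key
    omega
  · have hne : (site (p + 1) j : ℕ) ≠ p := by
      intro hh; apply h; ext; simpa using hh
    have : (j % ((p + 1 : ℕ) : ℤ) + 1) % ((p + 1 : ℕ) : ℤ) = j % ((p + 1 : ℕ) : ℤ) + 1 := by
      apply Int.emod_eq_of_lt <;> omega
    omega

lemma kron_mul (f g : Fin n → Matrix (Fin 2) (Fin 2) ℂ) :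
    kron f * kron g = kron (fun i => f i * g i) := by
  ext x y
  simp only [Matrix.mul_apply, kron, ← Finset.prod_mul_distrib]
  rw [Finset.prod_univ_sum]
  simp

lemma kron_smul_single (f g : Fin n → Matrix (Fin 2) (Fin 2) ℂ) (c : ℂ) (j : Fin n)
    (h : ∀ i, f i = (if i = j then c else 1) • g i) : kron f = c • kron g := by
  ext x y
  simp only [kron, Matrix.smul_apply, h, smul_eq_mul, Finset.prod_mul_distrib]
  simp

lemma kron_one : kron (fun _ : Fin n => (1 : Matrix (Fin 2) (Fin 2) ℂ)) = 1 := by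
  ext x y
  simp only [kron, Matrix.one_apply]
  split_ifs with h
  · simp [h]
  · obtain ⟨i, hi⟩ := Function.ne_iff.1 h
    exact Finset.prod_eq_zero (Finset.mem_univ i) (by simp [hi])

/-- `σx` to the power `a`, `a` modulo 2 -/
def xp (a : ZMod 2) : Matrix (Fin 2) (Fin 2) ℂ := if a = 0 then 1 else sx

/-- product of `σx` over the support of `a` -/
def fx (a : Fin n → ZMod 2) : M n := kron fun i => xp (a i)

lemma sx_sq : sx * sx = 1 := by
  ext i j; fin_cases i <;> fin_cases j <;> simp [sx, Matrix.mul_apply]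

lemma sz_sq : sz * sz = 1 := by
  ext i j; fin_cases i <;> fin_cases j <;> simp [sz, Matrix.mul_apply]

lemma sx_sz : sx * sz = -(sz * sx) := by
  ext i j; fin_cases i <;> fin_cases j <;> simp [sz, sx, Matrix.mul_apply]

lemma zmod2_cases (a : ZMod 2) : a = 0 ∨ a = 1 := by
  revert a; decide

lemma xp_mul (a b : ZMod 2) : xp a * xp b = xp (a + b) := by
  have h11 : (1 + 1 : ZMod 2) = 0 := by decide
  rcases zmod2_cases a with rfl | rfl <;> rcases zmod2_cases b with rfl | rfl <;>
    simp [xp, sx_sq, h11]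

lemma fx_mul (a b : Fin n → ZMod 2) : fx a * fx b = fx (a + b) := by
  simp only [fx, kron_mul, xp_mul, Pi.add_apply]

lemma fx_zero : fx (0 : Fin n → ZMod 2) = 1 := by
  simp only [fx, Pi.zero_apply, xp, if_true, kron_one]

/-- `σx` at site `j` -/
def xs (j : Fin n) : M n := fx (Pi.single j 1)

/-- `σz` at site `j` -/
def zs (j : Fin n) : M n := pauliAt n sz j

lemma xs_eq (j : Fin n) : pauliAt n sx j = xs j := by
  simp only [xs, fx, pauliAt]
  congr 1; funext i
  by_cases h : i = j
  · subst h; simp [xp]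
  · simp [xp, h]

lemma zs_sq (j : Fin n) : zs j * zs j = 1 := by
  simp only [zs, pauliAt, kron_mul]
  rw [← kron_one]; congr 1; funext i
  split_ifs <;> simp [sz_sq]

lemma zs_comm (j k : Fin n) : zs j * zs k = zs k * zs j := by
  simp only [zs, pauliAt, kron_mul]
  congr 1; funext i
  split_ifs <;> simp

/-- sign attached to an element of `ZMod 2` -/
def sg (a : ZMod 2) : ℂ := if a = 0 then 1 else -1

lemma fx_zs (a : Fin n → ZMod 2) (j : Fin n) : zs j * fx a = sg (a j) • (fx a * zs j) := by
  simp only [zs, pauliAt, fx, kron_mul]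
  apply kron_smul_single _ _ _ j
  intro i
  by_cases h : i = j
  · subst h
    rcases zmod2_cases (a i) with h | h <;> simp [h, xp, sg, sx_sz]
  · simp [h]

lemma zs_diag (j : Fin n) : (zs j : M n) = Matrix.diagonal fun x => if x j = 0 then (1 : ℂ) else -1 := by
  ext x y
  simp only [zs, pauliAt, kron, Matrix.diagonal_apply]
  split_ifs with h h2
  · subst h
    apply Finset.prod_eq_one
    intro i _
    split_ifs with hij
    · subst hij; simp [sz, h2]
    · simp
  · subst h
    rw [Finset.prod_eq_single j]
    · have : x j = 1 := by omega
      simp [sz, this]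
    · intro i _ hij; simp [hij]
    · simp
  · obtain ⟨i, hi⟩ := Function.ne_iff.1 h
    apply Finset.prod_eq_zero (Finset.mem_univ i)
    split_ifs
    · have : (x i = 0 ∧ y i = 1) ∨ (x i = 1 ∧ y i = 0) := by omega
      rcases this with ⟨h1, h2⟩ | ⟨h1, h2⟩ <;> simp [h1, h2, sz]
    · simp [hi]

lemma fx_col (a : Fin n → ZMod 2) (x : Fin n → Fin 2) :
    fx a x 0 = if x = (fun i => if a i = 0 then (0 : Fin 2) else 1) then 1 else 0 := by
  simp only [fx, kron]
  split_ifs with h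
  · subst h
    apply Finset.prod_eq_one
    intro i _
    change xp (a i) (if a i = 0 then (0 : Fin 2) else 1) 0 = 1
    rcases zmod2_cases (a i) with h | h
    · rw [if_pos h, xp, if_pos h]; rfl
    · have h' : a i ≠ 0 := by rw [h]; decide
      rw [if_neg h', xp, if_neg h']; simp [sx]
  · obtain ⟨i, hi⟩ := Function.ne_iff.1 h
    apply Finset.prod_eq_zero (Finset.mem_univ i)
    have : x i = 0 ∨ x i = 1 := by omega
    rcases zmod2_cases (a i) with h | h <;> rcases this with h3 | h3 <;>
      simp_all [xp, sx]

/-! ### Commutators with the generators -/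

lemma H1_zs (j : Fin n) : H1 n * zs j - zs j * H1 n = (2 : ℂ) • (xs j * zs j) ∧
    xs j * zs j = - (zs j * xs j) := by
  have anti : xs j * zs j = - (zs j * xs j) := by
    have h := fx_zs (Pi.single j 1 : Fin n → ZMod 2) j
    simp only [Pi.single_eq_same, sg] at h
    rw [if_neg (by decide)] at h
    simp only [xs]; rw [h]; simp
  refine ⟨?_, anti⟩
  simp only [H1, xs_eq, Finset.sum_mul, Finset.mul_sum, ← Finset.sum_sub_distrib]
  rw [Finset.sum_eq_single j]
  · rw [two_smul]; nth_rw 3 [anti]; rw [← sub_eq_add_neg]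
  · intro i _ hij
    have h := fx_zs (Pi.single i 1 : Fin n → ZMod 2) j
    simp only [Pi.single_eq_of_ne (Ne.symm hij), sg, if_true, one_smul] at h
    simp only [xs, h, sub_self]
  · simp

lemma H1_fx (a : Fin n → ZMod 2) : H1 n * fx a = fx a * H1 n := by
  simp only [H1, xs_eq, Finset.sum_mul, Finset.mul_sum, xs, fx_mul, add_comm]

lemma H0_zs (j : Fin n) : H0 n * zs j = zs j * H0 n := by
  simp only [H0, Finset.sum_mul, Finset.mul_sum]
  refine Finset.sum_congr rfl fun i _ => ?_
  change zs i * zs _ * zs j = zs j * (zs i * zs _)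
  rw [mul_assoc, zs_comm _ j, ← mul_assoc, zs_comm i j, mul_assoc]

lemma zs_xs_ne {i j : Fin n} (h : i ≠ j) : zs i * xs j = xs j * zs i := by
  have h' := fx_zs (Pi.single j 1 : Fin n → ZMod 2) i
  simp only [Pi.single_eq_of_ne h, sg, if_true, one_smul] at h'
  exact h'

lemma site_succ_ne (hn : 3 ≤ n) (t : ℤ) : site n (t + 1) ≠ site n t := by
  rw [Ne, site_eq_iff]
  rintro ⟨c, hc⟩
  have : (n : ℤ) ∣ 1 := ⟨c, by linarith⟩
  have := Int.le_of_dvd one_pos this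
  omega

/-- bond operator -/
def eb (t : ℤ) : M n := zs (site n (t - 1)) * zs (site n t)

lemma eb_xs (hn : 3 ≤ n) (t : ℤ) :
    (eb t : M n) * xs (site n t) = - (xs (site n t) * eb t) := by
  have h := site_succ_ne hn (t - 1)
  rw [sub_add_cancel] at h
  have a := (H1_zs (site n t)).2
  rw [eb, mul_assoc, ← mul_assoc (xs _), ← zs_xs_ne h.symm, mul_assoc, a]
  simp

lemma eb_xs' (hn : 3 ≤ n) (t : ℤ) :
    (eb (t + 1) : M n) * xs (site n t) = - (xs (site n t) * eb (t + 1)) := by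
  have h := site_succ_ne hn t
  have a := (H1_zs (site n t)).2
  rw [eb, add_sub_cancel_right, mul_assoc, ← mul_assoc (xs _), a, zs_xs_ne h]
  simp [mul_assoc]

lemma H0_xs (hn : 3 ≤ n) (t : ℤ) : H0 n * xs (site n t) - xs (site n t) * H0 n =
    (2 : ℂ) • ((eb t + eb (t + 1)) * xs (site n t)) := by
  have h1 := site_succ_ne hn (t - 1)
  rw [sub_add_cancel] at h1
  have h2 := site_succ_ne hn t
  have hr1 : finRotate n (site n (t - 1)) = site n t := by rw [rot_site, sub_add_cancel]
  have hr2 : finRotate n (site n t) = site n (t + 1) := rot_site t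
  simp only [H0, Finset.sum_mul, Finset.mul_sum, ← Finset.sum_sub_distrib]
  rw [Finset.sum_eq_add (site n (t - 1)) (site n t) h1.symm]
  · rw [hr1, hr2]
    have e1 : pauliAt n sz (site n (t - 1)) * pauliAt n sz (site n t) = eb t := rfl
    have e2 : pauliAt n sz (site n t) * pauliAt n sz (site n (t + 1)) = eb (t + 1) := by
      rw [eb, add_sub_cancel_right]; rfl
    rw [e1, e2, ← neg_eq_iff_eq_neg.2 (eb_xs hn t), ← neg_eq_iff_eq_neg.2 (eb_xs' hn t), add_mul,
      two_smul]
    abel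
  · intro i _ hi
    have hi2 : finRotate n i ≠ site n t := by
      intro h; rw [← hr1] at h; exact hi.1 ((finRotate n).injective h)
    change zs i * zs (finRotate n i) * _ - _ * (zs i * zs (finRotate n i)) = 0
    rw [mul_assoc, zs_xs_ne hi2, ← mul_assoc, zs_xs_ne hi.2, mul_assoc, sub_self]
  · simp
  · simp

/-! ### Strings -/

lemma ediv_step (a : ℤ) : a / n = (a - 1) / n + if (n : ℤ) ∣ a then 1 else 0 := by
  have h0 : (0 : ℤ) < n := npos
  have h1 := Int.emod_nonneg a h0.ne'
  have h2 := Int.emod_lt_of_pos a h0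
  have h3 := Int.mul_ediv_add_emod a n
  split_ifs with h
  · have h4 := Int.emod_eq_zero_of_dvd h
    have : (a - 1) = (n - 1) + n * (a / n - 1) := by linarith
    have e : (a - 1) / n = a / n - 1 := by
      rw [this, Int.add_mul_ediv_left _ _ h0.ne', Int.ediv_eq_zero_of_lt (by omega) (by omega)]; ring
    omega
  · have h4 : a % n ≠ 0 := fun h' => h (Int.dvd_of_emod_eq_zero h')
    have : (a - 1) = (a % n - 1) + n * (a / n) := by linarith
    have e : (a - 1) / n = a / n := by
      rw [this, Int.add_mul_ediv_left _ _ h0.ne', Int.ediv_eq_zero_of_lt (by omega) (by omega)]; ring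
    omega

lemma ediv_neg_step (a : ℤ) : (-a - 1) / n = - (a / n) - 1 := by
  have h0 : (0 : ℤ) < n := npos
  have h1 := Int.emod_nonneg a h0.ne'
  have h2 := Int.emod_lt_of_pos a h0
  have h3 := Int.mul_ediv_add_emod a n
  have : (-a - 1) = (n - 1 - a % n) + n * (- (a / n) - 1) := by linarith
  rw [this, Int.add_mul_ediv_left _ _ h0.ne', Int.ediv_eq_zero_of_lt (by omega) (by omega)]; ring

/-- parity of the number of occurrences of the site `i` among the positions below `s` -/
def kap (s : ℤ) (i : Fin n) : ZMod 2 := (((s - 1 - (i : ℕ)) / n : ℤ) : ZMod 2)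

lemma z2_self (a : ZMod 2) : a + a = 0 := by revert a; decide

lemma kap_succ (s : ℤ) : (kap (s + 1) : Fin n → ZMod 2) = Pi.single (site n s) 1 + kap s := by
  funext i
  simp only [kap, Pi.add_apply]
  have h := ediv_step (n := n) (s - (i : ℕ))
  have e1 : s + 1 - 1 - ((i : ℕ) : ℤ) = s - (i : ℕ) := by ring
  have e2 : s - 1 - ((i : ℕ) : ℤ) = s - (i : ℕ) - 1 := by ring
  rw [e1, e2, h]
  have hs := site_eq_iff (n := n) s (i : ℕ)
  rw [site_coe] at hs
  by_cases hd : (n : ℤ) ∣ s - (i : ℕ)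
  · rw [if_pos hd, hs.2 hd]; simp [add_comm]
  · rw [if_neg hd, Pi.single_eq_of_ne (fun h => hd (hs.1 h.symm))]; simp

lemma kap_add_n (s : ℤ) (i : Fin n) : kap (s + n) i = kap s i + 1 := by
  have h0 : (0 : ℤ) < n := npos
  simp only [kap]
  have : s + n - 1 - ((i : ℕ) : ℤ) = (s - 1 - (i : ℕ)) + n * 1 := by ring
  rw [this, Int.add_mul_ediv_left _ _ h0.ne']; simp

lemma kap_site (s t j : ℤ) : kap s (site n j) + kap t (site n j) =
    (((s - 1 - j) / n + (t - 1 - j) / n : ℤ) : ZMod 2) := by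
  have h0 : (0 : ℤ) < n := npos
  have h3 := Int.mul_ediv_add_emod j n
  simp only [kap, site_val]
  have e (s : ℤ) : s - 1 - j % n = (s - 1 - j) + n * (j / n) := by linarith
  rw [e, e, Int.add_mul_ediv_left _ _ h0.ne', Int.add_mul_ediv_left _ _ h0.ne']
  push_cast
  have := z2_self ((j / n : ℤ) : ZMod 2)
  linear_combination this

/-- `σx` string between positions `s` and `t` -/
def U (s t : ℤ) : M n := fx (kap s + kap t)

lemma U_self (s : ℤ) : (U s s : M n) = 1 := by
  have : (kap s + kap s : Fin n → ZMod 2) = 0 := by funext i; exact z2_self _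
  rw [U, this, fx_zero]

lemma U_comm (s t : ℤ) : (U s t : M n) = U t s := by rw [U, U, add_comm]

lemma xs_U (s t : ℤ) : xs (site n s) * U s t = U (s + 1) t := by
  rw [U, U, xs, fx_mul, kap_succ, add_assoc]

lemma xs_xs (j : Fin n) : xs j * xs j = 1 := by
  rw [xs, fx_mul, ← fx_zero]; congr 1; funext i; exact z2_self _

lemma xs_U' (s t : ℤ) : xs (site n s) * U (s + 1) t = U s t := by
  rw [← xs_U, ← mul_assoc, xs_xs, one_mul]

lemma U_xs_comm (s t : ℤ) (j : Fin n) : U s t * xs j = xs j * U s t := by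
  rw [U, xs, fx_mul, fx_mul, add_comm]

lemma U_xs (s t : ℤ) : U s t * xs (site n t) = U s (t + 1) := by
  rw [U_xs_comm, U_comm, xs_U, U_comm]

lemma U_xs' (s t : ℤ) : U s (t + 1) * xs (site n t) = U s t := by
  rw [U_xs_comm, U_comm, xs_U', U_comm]

lemma U_shift_n (s t : ℤ) : (U (s + n) (t + n) : M n) = U s t := by
  simp only [U]; congr 1; funext i
  simp only [Pi.add_apply, kap_add_n]
  have := z2_self (1 : ZMod 2)
  linear_combination this

lemma U_shift_2n (s t : ℤ) : (U s (t + 2 * n) : M n) = U s t := by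
  simp only [U]; congr 1; funext i
  have : t + 2 * n = t + n + n := by ring
  simp only [Pi.add_apply, this, kap_add_n]
  have := z2_self (1 : ZMod 2)
  linear_combination this

/-- commutator of `H0` with a string -/
lemma H0_U (hn : 3 ≤ n) (s t : ℤ) : H0 n * U s t - U s t * H0 n =
    (2 : ℂ) • (eb s * U s t - U s t * eb t) := by
  have key : ∀ t : ℤ, ∀ e : ℤ, (e = t ∨ e = t + 1) → ∀ e' : ℤ, e + e' = t + (t + 1) → ∀ W : M n,
      H0 n * W - W * H0 n = (2 : ℂ) • (eb s * W - W * eb e) →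
      H0 n * (W * xs (site n t)) - (W * xs (site n t)) * H0 n =
      (2 : ℂ) • (eb s * (W * xs (site n t)) - (W * xs (site n t)) * eb e') := by
    intro t e he e' hee W hW
    have h1 := H0_xs hn t
    have h2 : (eb e' : M n) * xs (site n t) = - (xs (site n t) * eb e') := by
      rcases he with rfl | rfl
      · have : e' = e + 1 := by omega
        subst this; exact eb_xs' hn e
      · have : e' = t := by omega
        subst this; exact eb_xs hn e'
    have h3 : (eb t + eb (t + 1) : M n) = eb e + eb e' := by
      rcases he with rfl | rfl
      · have : e' = e + 1 := by omega
        rw [this]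
      · have : e' = t := by omega
        rw [this, add_comm]
    rw [h3] at h1
    have h4 : xs (site n t) * eb e' = - ((eb e' : M n) * xs (site n t)) := by rw [h2, neg_neg]
    calc H0 n * (W * xs (site n t)) - (W * xs (site n t)) * H0 n
        = (H0 n * W - W * H0 n) * xs (site n t)
          + W * (H0 n * xs (site n t) - xs (site n t) * H0 n) := by noncomm_ring
      _ = _ := by
        rw [hW, h1, mul_assoc W _ (eb e'), h4]
        simp only [two_smul]
        noncomm_ring
  obtain ⟨l, rfl⟩ : ∃ l, t = s + l := ⟨t - s, by ring⟩
  induction l using Int.induction_on with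
  | zero => rw [add_zero, U_self]; simp
  | succ i ih =>
    have := key (s + i) (s + i) (Or.inl rfl) (s + i + 1) rfl _ ih
    rw [U_xs] at this
    rw [← add_assoc]; exact this
  | pred i ih =>
    have e : s + (-(i : ℤ)) = s + (-(i : ℤ) - 1) + 1 := by ring
    have := key (s + (-(i : ℤ) - 1)) (s + (-(i : ℤ))) (Or.inr e) (s + (-(i : ℤ) - 1))
      (by ring) _ ih
    rw [e, U_xs'] at this
    exact this

/-- general Pauli string -/
def V (j s t k : ℤ) : M n := zs (site n j) * U s t * zs (site n k)

lemma V_shift_n (j s t k : ℤ) : (V (j + n) (s + n) (t + n) (k + n) : M n) = V j s t k := by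
  simp only [V, site_add_n, U_shift_n]

lemma V_shift_2n (j s t k : ℤ) : (V j s (t + 2 * n) (k + 2 * n) : M n) = V j s t k := by
  have : k + 2 * n = k + n + n := by ring
  simp only [V, this, site_add_n, U_shift_2n]

lemma H1_V (j s t k : ℤ) : H1 n * V j s t k - V j s t k * H1 n =
    (2 : ℂ) • (zs (site n j) * U s t * (xs (site n k) * zs (site n k))
      - zs (site n j) * (xs (site n j) * U s t) * zs (site n k)) := by
  have h1 := H1_zs (site n j)
  have h2 := H1_zs (site n k)
  have h3 : H1 n * U s t = U s t * H1 n := H1_fx _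
  rw [h1.2] at h1
  calc H1 n * V j s t k - V j s t k * H1 n
      = (H1 n * zs (site n j) - zs (site n j) * H1 n) * U s t * zs (site n k)
        + zs (site n j) * U s t * (H1 n * zs (site n k) - zs (site n k) * H1 n)
        + zs (site n j) * (H1 n * U s t - U s t * H1 n) * zs (site n k) := by
          simp only [V]; noncomm_ring
    _ = _ := by
      rw [h1.1, h2.1, h3]
      simp only [two_smul]
      noncomm_ring

lemma H0_V (hn : 3 ≤ n) (j s t k : ℤ) : H0 n * V j s t k - V j s t k * H0 n =
    (2 : ℂ) • (zs (site n j) * eb s * U s t * zs (site n k)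
      - zs (site n j) * U s t * (eb t * zs (site n k))) := by
  have h1 := H0_zs (site n j)
  have h2 := H0_zs (site n k)
  have h3 := H0_U hn s t
  calc H0 n * V j s t k - V j s t k * H0 n
      = (H0 n * zs (site n j) - zs (site n j) * H0 n) * U s t * zs (site n k)
        + zs (site n j) * U s t * (H0 n * zs (site n k) - zs (site n k) * H0 n)
        + zs (site n j) * (H0 n * U s t - U s t * H0 n) * zs (site n k) := by
          simp only [V]; noncomm_ring
    _ = _ := by
      rw [h1, h2, h3]
      simp only [two_smul]
      noncomm_ring

/-- reversal of a string -/
lemma V_rev (j s t k : ℤ) : (V j s t k : M n) =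
    (sg (kap s (site n j) + kap t (site n j)) * sg (kap s (site n k) + kap t (site n k))) •
      V k t s j := by
  have h1 := fx_zs (kap s + kap t) (site n j)
  have h2 := fx_zs (kap s + kap t) (site n k)
  simp only [Pi.add_apply] at h1 h2
  simp only [V, U_comm t s]
  rw [U, h1, h2, smul_mul_assoc, smul_mul_assoc, mul_assoc, zs_comm, ← mul_assoc, smul_smul]
  congr 1
  rcases zmod2_cases (kap s (site n k) + kap t (site n k)) with h | h <;> rw [h] <;> simp [sg]

lemma sg_int (a b : ℤ) : sg (a : ZMod 2) * sg (b : ZMod 2) = sg ((a + b : ℤ) : ZMod 2) := by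
  push_cast
  rcases zmod2_cases (a : ZMod 2) with h | h <;> rcases zmod2_cases (b : ZMod 2) with h' | h' <;>
    rw [h, h'] <;> simp [sg, z2_self]

lemma sg_even (a : ℤ) : sg ((2 * a : ℤ) : ZMod 2) = 1 := by
  have : ((2 * a : ℤ) : ZMod 2) = 0 := by
    rw [two_mul]; push_cast; exact z2_self _
  rw [this, sg, if_pos rfl]

/-! ### The Onsager family -/

def S (j k : ℤ) : M n := V j (j + 1) k k
def Q (j k : ℤ) : M n := V j j k k
def R (j k : ℤ) : M n := V j (j + 1) (k + 1) k

lemma S_rev (j k : ℤ) : (S j k : M n) = V k k (j + 1) j := by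
  rw [S, V_rev, kap_site, kap_site, sg_int]
  have e := ediv_neg_step (n := n) (j - k)
  have e1 : -(j - k) - 1 = k - 1 - j := by ring
  have e2 : j + 1 - 1 - k = j - k := by ring
  have e3 : (k - 1 - k) / (n : ℤ) = -1 := by
    have := ediv_neg_step (n := n) 0
    simpa using this
  have e4 : (j + 1 - 1 - j) / (n : ℤ) = 0 := by simp
  rw [e1] at e
  rw [e2, e3, e4, e]
  have : (0 + (-((j - k) / (n : ℤ)) - 1) + ((j - k) / (n : ℤ) + -1)) = 2 * (-1) := by ring
  rw [this, sg_even, one_smul]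

lemma H1_S (j k : ℤ) : H1 n * S j k - S j k * H1 n = (2 : ℂ) • (R j k - Q j k) := by
  rw [S, H1_V, xs_U', ← mul_assoc, mul_assoc (zs _), U_xs]; rfl

lemma H1_Q (j k : ℤ) : H1 n * Q j k - Q j k * H1 n = (2 : ℂ) • (S k j - S j k) := by
  rw [S_rev k j, Q, H1_V, xs_U, ← mul_assoc, mul_assoc (zs _), U_xs]; rfl

lemma H1_R (j k : ℤ) : H1 n * R j k - R j k * H1 n = (2 : ℂ) • (S j k - S k j) := by
  rw [S_rev k j, R, H1_V, xs_U', ← mul_assoc, mul_assoc (zs _), U_xs']; rfl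

lemma zs_eb (j : ℤ) : zs (site n j) * eb (j + 1) = zs (site n (j + 1)) := by
  rw [eb, add_sub_cancel_right, ← mul_assoc, zs_sq, one_mul]

lemma zs_eb' (j : ℤ) : zs (site n j) * eb j = zs (site n (j - 1)) := by
  rw [eb, zs_comm (site n (j - 1)), ← mul_assoc, zs_sq, one_mul]

lemma eb_zs (j : ℤ) : eb j * zs (site n j) = zs (site n (j - 1)) := by
  rw [eb, mul_assoc, zs_sq, mul_one]

lemma eb_zs' (j : ℤ) : eb (j + 1) * zs (site n j) = zs (site n (j + 1)) := by
  rw [eb, add_sub_cancel_right, zs_comm (site n j), mul_assoc, zs_sq, mul_one]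

lemma H0_S (hn : 3 ≤ n) (j k : ℤ) :
    H0 n * S j k - S j k * H0 n = (2 : ℂ) • (Q (j + 1) k - R j (k - 1)) := by
  rw [S, H0_V hn, zs_eb, eb_zs, R, sub_add_cancel]; rfl

lemma H0_Q (hn : 3 ≤ n) (j k : ℤ) :
    H0 n * Q j k - Q j k * H0 n = (2 : ℂ) • (S (j - 1) k - S (k - 1) j) := by
  rw [Q, H0_V hn, zs_eb', eb_zs, S_rev (k - 1), S, sub_add_cancel, sub_add_cancel]; rfl

lemma H0_R (hn : 3 ≤ n) (j k : ℤ) :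
    H0 n * R j k - R j k * H0 n = (2 : ℂ) • (S k (j + 1) - S j (k + 1)) := by
  rw [R, H0_V hn, zs_eb, eb_zs', S_rev k, S]; rfl

lemma sum_shift {T : Type*} [AddCommGroup T] (f : ℤ → T) (N : ℕ) (hf : ∀ j, f (j + N) = f j)
    (c : ℤ) : ∑ i ∈ Finset.range N, f (i + c) = ∑ i ∈ Finset.range N, f i := by
  have step : ∀ c : ℤ, ∑ i ∈ Finset.range N, f (i + (c + 1)) = ∑ i ∈ Finset.range N, f (i + c) := by
    intro c
    have h1 := Finset.sum_range_succ (fun i : ℕ => f (i + c)) N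
    have h2 := Finset.sum_range_succ' (fun i : ℕ => f (i + c)) N
    rw [h1] at h2
    have h3 : f (N + c) = f c := by rw [add_comm, hf]
    simp only [h3, Nat.cast_zero, zero_add] at h2
    rw [add_right_cancel h2]
    refine Finset.sum_congr rfl fun i _ => ?_
    congr 1; push_cast; ring
  induction c using Int.induction_on with
  | zero => simp
  | succ i ih => rw [step, ih]
  | pred i ih => rw [← ih, ← step]; simp

lemma S_shift (j k : ℤ) : (S (j + n) (k + n) : M n) = S j k := by
  rw [S, S, ← V_shift_n j]; congr 1; ring
lemma Q_shift (j k : ℤ) : (Q (j + n) (k + n) : M n) = Q j k := by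
  rw [Q, Q, ← V_shift_n j]
lemma R_shift (j k : ℤ) : (R (j + n) (k + n) : M n) = R j k := by
  rw [R, R, ← V_shift_n j]; congr 1 <;> ring
lemma S_2n (j k : ℤ) : (S j (k + 2 * n) : M n) = S j k := V_shift_2n _ _ _ _
lemma Q_2n (j k : ℤ) : (Q j (k + 2 * n) : M n) = Q j k := V_shift_2n _ _ _ _
lemma R_2n (j k : ℤ) : (R j (k + 2 * n) : M n) = R j k := by
  have := V_shift_2n (n := n) j (j + 1) (k + 1) k
  rw [R, R, ← this]; congr 1; ring

def A (m : ℤ) : M n := ∑ i ∈ Finset.range n, S i (i + m)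
def D (m : ℤ) : M n := ∑ i ∈ Finset.range n, (Q i (i + m) - R i (i + m))

lemma A_gen (m c : ℤ) : (A m : M n) = ∑ i ∈ Finset.range n, S (i + c) (i + c + m) :=
  (sum_shift (fun j => (S j (j + m) : M n)) n (fun j => by
    have := S_shift (n := n) j (j + m); rw [← this]; congr 1; ring) c).symm

lemma Qs_gen (m c : ℤ) : ∑ i ∈ Finset.range n, (Q i (i + m) : M n) =
    ∑ i ∈ Finset.range n, Q (i + c) (i + c + m) :=
  (sum_shift (fun j => (Q j (j + m) : M n)) n (fun j => by
    have := Q_shift (n := n) j (j + m); rw [← this]; congr 1; ring) c).symm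

lemma A_2n (m : ℤ) : (A (m + 2 * n) : M n) = A m := by
  simp only [A, ← add_assoc, S_2n]

lemma D_2n (m : ℤ) : (D (m + 2 * n) : M n) = D m := by
  simp only [D, ← add_assoc, Q_2n, R_2n]

lemma QR_eq (j k : ℤ) (h : (n : ℤ) ∣ j - k) : (Q j k : M n) = R j k := by
  have hs : site n j = site n k := (site_eq_iff j k).2 h
  have : (U (j + 1) (k + 1) : M n) = U j k := by
    rw [← xs_U, ← U_xs, U_xs_comm, ← mul_assoc, hs, xs_xs, one_mul]
  rw [Q, R, V, V, this]

lemma QR_anti_aux (j s k : ℤ) (d : ℤ) (hs : s = j + d) (hd : d = 0 ∨ d = 1)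
    (h : ¬ (n : ℤ) ∣ j - k) :
    (V j s (k + d) k : M n) = - V k (k + d) s j := by
  rw [V_rev, kap_site, kap_site, sg_int]
  have e := ediv_neg_step (n := n) (j - k)
  have e' := ediv_step (n := n) (j - k)
  have f := ediv_neg_step (n := n) (k - j)
  have f' := ediv_step (n := n) (k - j)
  have h' : ¬ (n : ℤ) ∣ k - j := by rwa [dvd_sub_comm]
  rw [if_neg h] at e'
  rw [if_neg h'] at f'
  have m1 : (-1) / (n : ℤ) = -1 := by simpa using ediv_neg_step (n := n) 0
  have key : ∃ c : ℤ, (s - 1 - j) / (n : ℤ) + (k + d - 1 - j) / n + ((s - 1 - k) / n + (k + d - 1 - k) / n)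
      = 2 * c + 1 := by
    have e1 : -(j - k) - 1 = k - j - 1 := by ring
    have e2 : -(k - j) - 1 = j - k - 1 := by ring
    rw [e1] at e
    rw [e2] at f
    subst hs
    rcases hd with rfl | rfl
    · refine ⟨-2, ?_⟩
      have a1 : j + 0 - 1 - j = -1 := by ring
      have a2 : k + 0 - 1 - j = k - j - 1 := by ring
      have a3 : j + 0 - 1 - k = j - k - 1 := by ring
      have a4 : k + 0 - 1 - k = -1 := by ring
      rw [a1, a2, a3, a4, m1]; omega
    · refine ⟨-1, ?_⟩
      have a1 : j + 1 - 1 - j = 0 := by ring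
      have a2 : k + 1 - 1 - j = k - j := by ring
      have a3 : j + 1 - 1 - k = j - k := by ring
      have a4 : k + 1 - 1 - k = 0 := by ring
      rw [a1, a2, a3, a4, Int.zero_ediv]; omega
  obtain ⟨c, hc⟩ := key
  rw [hc, ← sg_int, sg_even]
  have : sg ((1 : ℤ) : ZMod 2) = -1 := by simp [sg]
  rw [this]; simp

lemma QR_anti (j k : ℤ) : (Q k j - R k j : M n) = - (Q j k - R j k) := by
  by_cases h : (n : ℤ) ∣ j - k
  · rw [QR_eq j k h, QR_eq k j (by rwa [dvd_sub_comm])]; simp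
  · have h1 := QR_anti_aux (n := n) j j k 0 (by ring) (Or.inl rfl) h
    have h2 := QR_anti_aux (n := n) j (j + 1) k 1 rfl (Or.inr rfl) h
    rw [add_zero] at h1
    rw [Q, R, Q, R, h1, h2]; abel

lemma D_gen (m c : ℤ) : (D m : M n) = ∑ i ∈ Finset.range n,
    (Q (i + c) (i + c + m) - R (i + c) (i + c + m)) :=
  (sum_shift (fun j => (Q j (j + m) - R j (j + m) : M n)) n (fun j => by
    have := Q_shift (n := n) j (j + m)
    have h2 := R_shift (n := n) j (j + m)
    rw [← this, ← h2]; congr 2 <;> ring) c).symm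

lemma D_neg (m : ℤ) : (D (-m) : M n) = - D m := by
  rw [D_gen (-m) m, D, ← Finset.sum_neg_distrib]
  refine Finset.sum_congr rfl fun i _ => ?_
  rw [add_neg_cancel_right, QR_anti]

lemma D_zero : (D 0 : M n) = 0 := by
  rw [D]; apply Finset.sum_eq_zero; intro i _
  rw [add_zero, QR_eq _ _ (by simp), sub_self]

lemma D_n : (D n : M n) = 0 := by
  rw [D]; apply Finset.sum_eq_zero; intro i _
  rw [QR_eq _ _ (by simp), sub_self]

lemma H1_A (m : ℤ) : H1 n * A m - A m * H1 n = (-2 : ℂ) • D m := by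
  rw [A, D, Finset.mul_sum, Finset.sum_mul, ← Finset.sum_sub_distrib, Finset.smul_sum]
  refine Finset.sum_congr rfl fun i _ => ?_
  rw [H1_S, neg_smul, ← smul_neg, neg_sub]

lemma H1_D (m : ℤ) : H1 n * D m - D m * H1 n = (-4 : ℂ) • (A m - A (-m)) := by
  have : (A (-m) : M n) = ∑ i ∈ Finset.range n, S (i + m) i := by
    rw [A_gen (-m) m]; simp
  rw [this, A, D, Finset.mul_sum, Finset.sum_mul, ← Finset.sum_sub_distrib,
    ← Finset.sum_sub_distrib, Finset.smul_sum]
  refine Finset.sum_congr rfl fun i _ => ?_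
  have h1 := H1_Q (n := n) i (i + m)
  have h2 := H1_R (n := n) i (i + m)
  rw [mul_sub, sub_mul, sub_sub_sub_comm, h1, h2, ← smul_sub,
    show (-4 : ℂ) = 2 * (-2) by norm_num, mul_smul]
  congr 1
  rw [neg_smul, two_smul]; abel

lemma H0_A (hn : 3 ≤ n) (m : ℤ) : H0 n * A m - A m * H0 n = (2 : ℂ) • D (m - 1) := by
  have h : (D (m - 1) : M n) =
      ∑ i ∈ Finset.range n, (Q (i + 1) (i + m) - R i (i + m - 1)) := by
    rw [D, Finset.sum_sub_distrib, Finset.sum_sub_distrib, Qs_gen _ 1]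
    have e1 : ∀ i : ℤ, i + 1 + (m - 1) = i + m := fun i => by ring
    have e2 : ∀ i : ℤ, i + (m - 1) = i + m - 1 := fun i => by ring
    simp only [e1, e2]
  rw [h, A, Finset.mul_sum, Finset.sum_mul, ← Finset.sum_sub_distrib, Finset.smul_sum]
  refine Finset.sum_congr rfl fun i _ => ?_
  rw [H0_S hn]

lemma H0_D (hn : 3 ≤ n) (m : ℤ) :
    H0 n * D m - D m * H0 n = (4 : ℂ) • (A (m + 1) - A (1 - m)) := by
  have t1 : (A (m + 1) : M n) = ∑ i ∈ Finset.range n, S (i - 1) (i + m) := by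
    rw [A_gen _ (-1)]; refine Finset.sum_congr rfl fun i _ => ?_; congr 1; ring
  have t2 : (A (m + 1) : M n) = ∑ i ∈ Finset.range n, S i (i + m + 1) := by
    rw [A]; refine Finset.sum_congr rfl fun i _ => ?_; congr 1; ring
  have t3 : (A (1 - m) : M n) = ∑ i ∈ Finset.range n, S (i + m - 1) i := by
    rw [A_gen _ (m - 1)]; refine Finset.sum_congr rfl fun i _ => ?_; congr 1 <;> ring
  have t4 : (A (1 - m) : M n) = ∑ i ∈ Finset.range n, S (i + m) (i + 1) := by
    rw [A_gen _ m]; refine Finset.sum_congr rfl fun i _ => ?_; congr 1; ring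
  have : (4 : ℂ) • (A (m + 1) - A (1 - m) : M n) = (2 : ℂ) • (A (m + 1) - A (1 - m))
      - (2 : ℂ) • (A (1 - m) - A (m + 1)) := by
    module
  rw [this]
  nth_rw 1 [t1, t3]
  rw [t4, t2, D, Finset.mul_sum, Finset.sum_mul, ← Finset.sum_sub_distrib,
    ← Finset.sum_sub_distrib, ← Finset.sum_sub_distrib, Finset.smul_sum, Finset.smul_sum,
    ← Finset.sum_sub_distrib]
  refine Finset.sum_congr rfl fun i _ => ?_
  have h1 := H0_Q hn i (i + m)
  have h2 := H0_R hn i (i + m)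
  rw [mul_sub, sub_mul, sub_sub_sub_comm, h1, h2]

/-! ### The functionals -/

/-- number of flipped sites -/
def wt (x : Fin n → Fin 2) : ℕ := (Finset.univ.filter fun i => x i ≠ 0).card

/-- sum of the entries of weight `r` in the zeroth column -/
def F (r : ℕ) : M n →ₗ[ℂ] ℂ where
  toFun B := ∑ x ∈ Finset.univ.filter (fun x : Fin n → Fin 2 => wt x = r), B x 0
  map_add' B C := by simp [Finset.sum_add_distrib]
  map_smul' c B := by simp [Finset.mul_sum]

/-- size of the support -/
def sz2 (a : Fin n → ZMod 2) : ℕ := (Finset.univ.filter fun i => a i ≠ 0).card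

lemma F_V (r : ℕ) (j s t k : ℤ) : F r (V j s t k : M n) =
    if sz2 (kap s + kap t : Fin n → ZMod 2) = r
      then sg (kap s (site n j) + kap t (site n j)) else 0 := by
  set a : Fin n → ZMod 2 := kap s + kap t with ha
  set a' : Fin n → Fin 2 := fun i => if a i = 0 then (0 : Fin 2) else 1 with ha'
  have ent : ∀ x : Fin n → Fin 2, (V j s t k : M n) x 0 =
      if x = a' then sg (a (site n j)) else 0 := by
    intro x
    rw [V, U, zs_diag, zs_diag, Matrix.mul_diagonal, Matrix.diagonal_mul, fx_col, ← ha, ← ha']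
    have h0 : (0 : Fin n → Fin 2) (site n k) = 0 := rfl
    rw [if_pos h0, mul_one]
    split_ifs with h1 h2 h2
    · subst h2
      have : a (site n j) = 0 := by
        by_contra hne; simp [ha', hne] at h1
      simp [sg, this]
    · simp
    · subst h2
      have : a (site n j) ≠ 0 := by
        intro hne; simp [ha', hne] at h1
      simp [sg, this]
    · simp
  have hw : wt a' = sz2 a := by
    rw [wt, sz2]; congr 1; ext i; simp only [ha', Finset.mem_filter, Finset.mem_univ, true_and]
    split_ifs with h <;> simp [h]
  change ∑ x ∈ Finset.univ.filter (fun x : Fin n → Fin 2 => wt x = r), (V j s t k : M n) x 0 = _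
  simp only [ent, Finset.sum_ite_eq', Finset.mem_filter, Finset.mem_univ, true_and, hw]
  rfl

lemma sz2_kap (s : ℤ) (l : ℕ) (hl : l ≤ n) : sz2 (kap s + kap (s + l) : Fin n → ZMod 2) = l := by
  induction l with
  | zero =>
    have : (kap s + kap (s + (0 : ℕ)) : Fin n → ZMod 2) = 0 := by
      funext i; simp [z2_self]
    rw [this]; simp [sz2]
  | succ l ih =>
    have ih := ih (by omega)
    have h0 : (0 : ℤ) < n := npos
    have e : (kap s + kap (s + (l + 1 : ℕ)) : Fin n → ZMod 2) =
        Pi.single (site n (s + l)) 1 + (kap s + kap (s + l)) := by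
      have : s + ((l + 1 : ℕ) : ℤ) = s + l + 1 := by push_cast; ring
      rw [this, kap_succ]; abel
    have hz : (kap s + kap (s + l) : Fin n → ZMod 2) (site n (s + l)) = 0 := by
      rw [Pi.add_apply, kap_site]
      have a1 : s - 1 - (s + l) = -(l : ℤ) - 1 := by ring
      have a2 : s + l - 1 - (s + l) = -(0 : ℤ) - 1 := by ring
      rw [a1, a2, ediv_neg_step, ediv_neg_step, Int.ediv_eq_zero_of_lt (by omega) (by omega),
        Int.zero_ediv]
      decide
    rw [e]
    set b : Fin n → ZMod 2 := kap s + kap (s + l)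
    rw [sz2]
    have : (Finset.univ.filter fun i => ((Pi.single (site n (s + l)) 1 + b : Fin n → ZMod 2)) i ≠ 0) =
        insert (site n (s + l)) (Finset.univ.filter fun i => b i ≠ 0) := by
      ext i
      simp only [Finset.mem_filter, Finset.mem_univ, true_and, Finset.mem_insert, Pi.add_apply]
      by_cases hi : i = site n (s + l)
      · subst hi; simp [hz]
      · simp [hi]
    rw [this, Finset.card_insert_of_notMem (by simp [hz])]
    rw [sz2] at ih; rw [ih]

lemma sg0 : sg ((0 : ℤ) : ZMod 2) = 1 := by simp [sg]
lemma sgm1 : sg ((-1 : ℤ) : ZMod 2) = -1 := by simp [sg]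

lemma m1_ediv : (-1) / (n : ℤ) = -1 := by simpa using ediv_neg_step (n := n) 0

lemma F_A_pos (r m : ℕ) (h1 : 1 ≤ m) (h2 : m ≤ n) :
    F r (A (m : ℤ) : M n) = if m = r + 1 then (n : ℂ) else 0 := by
  rw [A, map_sum]
  have : ∀ i ∈ Finset.range n, F r (S (i : ℤ) (i + m) : M n) = if m = r + 1 then 1 else 0 := by
    intro i _
    have e : ((i : ℤ) + m) = (i + 1) + ((m - 1 : ℕ) : ℤ) := by omega
    rw [S, F_V, e, sz2_kap _ _ (by omega), kap_site]
    have a1 : (i : ℤ) + 1 - 1 - i = 0 := by ring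
    have a2 : (i : ℤ) + 1 + ((m - 1 : ℕ) : ℤ) - 1 - i = ((m - 1 : ℕ) : ℤ) := by ring
    rw [a1, a2, Int.zero_ediv, Int.ediv_eq_zero_of_lt (by omega) (by omega), add_zero, sg0]
    congr 1; simp only [eq_iff_iff]; omega
  rw [Finset.sum_congr rfl this]; simp

lemma F_A_neg (r p : ℕ) (h2 : p < n) :
    F r (A (-(p : ℤ)) : M n) = if r = p + 1 then -(n : ℂ) else 0 := by
  rw [A, map_sum]
  have : ∀ i ∈ Finset.range n, F r (S (i : ℤ) (i + -(p : ℤ)) : M n) =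
      if r = p + 1 then -1 else 0 := by
    intro i _
    have e : ((i : ℤ) + 1) = (i + -(p : ℤ)) + ((p + 1 : ℕ) : ℤ) := by push_cast; ring
    rw [S, F_V, add_comm (kap _) (kap _), kap_site]
    have hsz : sz2 (kap ((i : ℤ) + -(p : ℤ)) + kap ((i : ℤ) + 1) : Fin n → ZMod 2) = p + 1 := by
      rw [e]; exact sz2_kap _ _ (by omega)
    rw [hsz]
    have a1 : (i : ℤ) + 1 - 1 - i = 0 := by ring
    have a2 : (i : ℤ) + -p - 1 - i = -(p : ℤ) - 1 := by ring
    rw [a1, a2, Int.zero_ediv, ediv_neg_step, Int.ediv_eq_zero_of_lt (by omega) (by omega),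
      neg_zero, zero_sub, zero_add, sgm1]
    congr 1; simp only [eq_iff_iff]; omega
  rw [Finset.sum_congr rfl this]; simp

lemma F_D (r m : ℕ) (h1 : 1 ≤ m) (h2 : m < n) :
    F r (D (m : ℤ) : M n) = if m = r then -2 * (n : ℂ) else 0 := by
  rw [D, map_sum]
  have : ∀ i ∈ Finset.range n, F r (Q (i : ℤ) (i + m) - R (i : ℤ) (i + m) : M n) =
      if m = r then -2 else 0 := by
    intro i _
    have e : ((i : ℤ) + m + 1) = (i + 1) + (m : ℤ) := by ring
    rw [Q, R, map_sub, F_V, F_V, e, sz2_kap _ _ (by omega), sz2_kap _ _ (by omega), kap_site,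
      kap_site]
    have a1 : (i : ℤ) + 1 - 1 - i = 0 := by ring
    have a2 : (i : ℤ) + 1 + m - 1 - i = m := by ring
    have a3 : (i : ℤ) - 1 - i = -1 := by ring
    have a4 : (i : ℤ) + m - 1 - i = m - 1 := by ring
    rw [a1, a2, a3, a4, Int.zero_ediv, m1_ediv, Int.ediv_eq_zero_of_lt (by omega) (by omega),
      Int.ediv_eq_zero_of_lt (by omega) (by omega), add_zero, add_zero, sg0, sgm1]
    split_ifs <;> norm_num
  rw [Finset.sum_congr rfl this]; simp [mul_comm]

/-! ### Cyclic symmetrization -/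

lemma P_kron (f : Fin n → Matrix (Fin 2) (Fin 2) ℂ) :
    P n * kron f = kron (fun i => f (finRotate n i)) * P n := by
  ext x y
  have h1 : (P n * kron f) x y = kron f (fun i => x ((finRotate n).symm i)) y := by
    rw [Matrix.mul_apply, Finset.sum_eq_single (fun i => x ((finRotate n).symm i))]
    · simp [P]
    · intro w _ hw
      have : x ≠ fun i => w (finRotate n i) := by
        rintro rfl; apply hw; funext i; simp
      simp only [P, if_neg this, zero_mul]
    · simp
  have h2 : (kron (fun i => f (finRotate n i)) * P n) x y =
      kron (fun i => f (finRotate n i)) x (fun i => y (finRotate n i)) := by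
    rw [Matrix.mul_apply, Finset.sum_eq_single (fun i => y (finRotate n i))]
    · simp [P]
    · intro w _ hw
      simp only [P, if_neg hw, mul_zero]
    · simp
  rw [h1, h2]
  simp only [kron]
  rw [← Equiv.prod_comp (finRotate n)]
  simp

lemma P_unit : IsUnit (P n).det := by
  apply Matrix.isUnit_det_of_right_inverse (B := (P n)ᵀ)
  ext x y
  rw [Matrix.mul_apply, Finset.sum_eq_single (fun i => x ((finRotate n).symm i))]
  · simp only [P, Matrix.transpose_apply, Matrix.one_apply]
    simp [eq_comm]
  · intro w _ hw
    have : x ≠ fun i => w (finRotate n i) := by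
      rintro rfl; apply hw; funext i; simp
    simp only [P, if_neg this, zero_mul]
  · simp

lemma P_zs (j : ℤ) : P n * zs (site n j) = zs (site n (j - 1)) * P n := by
  rw [zs, pauliAt, P_kron, zs, pauliAt]
  congr 2; funext i
  have : finRotate n i = site n j ↔ i = site n (j - 1) := by
    have h := rot_site (n := n) (j - 1)
    rw [sub_add_cancel] at h
    rw [← h, (finRotate n).injective.eq_iff]
  simp only [this]

lemma P_U (s t : ℤ) : P n * U s t = U (s - 1) (t - 1) * P n := by
  rw [U, fx, P_kron, U, fx]
  congr 2; funext i
  congr 1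
  have h1 : finRotate n i = site n ((i : ℕ) + 1) := by
    rw [← rot_site, site_coe]
  have h2 : i = site n ((i : ℕ) : ℤ) := (site_coe i).symm
  simp only [Pi.add_apply]
  rw [h1, kap_site]
  nth_rw 3 [h2]
  nth_rw 4 [h2]
  rw [kap_site]
  congr 3 <;> ring

lemma P_V (j s t k : ℤ) : P n * V j s t k = V (j - 1) (s - 1) (t - 1) (k - 1) * P n := by
  simp only [V]
  rw [← mul_assoc, ← mul_assoc, P_zs, mul_assoc _ (P n), P_U, ← mul_assoc, mul_assoc _ (P n), P_zs,
    ← mul_assoc]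

lemma P_pow_V (j s t k : ℤ) (r : ℕ) :
    P n ^ r * V j s t k = V (j - r) (s - r) (t - r) (k - r) * P n ^ r := by
  induction r with
  | zero => simp
  | succ r ih =>
    rw [pow_succ', mul_assoc, ih, ← mul_assoc, P_V, mul_assoc]
    congr 1
    push_cast
    simp only [sub_sub]

lemma symmC_S (j m : ℤ) : symmC (S j (j + m) : M n) = A m := by
  have h : ∀ r ∈ Finset.range n, P n ^ r * S j (j + m) * (P n ^ r)⁻¹ =
      (fun r : ℕ => (S (r + (j - (n - 1))) (r + (j - (n - 1)) + m) : M n)) (n - 1 - r) := by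
    intro r hr
    rw [Finset.mem_range] at hr
    have hd : IsUnit (P n ^ r).det := by rw [Matrix.det_pow]; exact P_unit.pow r
    rw [S, P_pow_V, mul_assoc, Matrix.mul_nonsing_inv _ hd, mul_one]
    have : ((n - 1 - r : ℕ) : ℤ) = n - 1 - r := by omega
    simp only [this, S]
    congr 1 <;> ring
  rw [symmC, Finset.sum_congr rfl h,
    Finset.sum_range_reflect (fun r : ℕ => (S (r + (j - (n - 1))) (r + (j - (n - 1)) + m) : M n)),
    ← A_gen]

lemma symmC_smul (c : ℂ) (B : M n) : symmC (c • B) = c • symmC B := by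
  simp only [symmC, Finset.smul_sum, mul_smul_comm, smul_mul_assoc]

lemma eq_site_iff (i : Fin n) (a : ℕ) (h : a < n) : i = site n (a : ℤ) ↔ (i : ℕ) = a := by
  have : site n (a : ℤ) = ⟨a, h⟩ := site_coe ⟨a, h⟩
  rw [this, Fin.ext_iff]

lemma kap_val (s : ℕ) (hs : s ≤ n) (i : Fin n) :
    kap (s : ℤ) i = if (i : ℕ) < s then 0 else 1 := by
  have hi := i.2
  split_ifs with h
  · rw [kap, Int.ediv_eq_zero_of_lt (by omega) (by omega)]; rfl
  · have e : (s : ℤ) - 1 - (i : ℕ) = -((i : ℕ) - (s : ℤ)) - 1 := by ring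
    rw [kap, e, ediv_neg_step, Int.ediv_eq_zero_of_lt (by omega) (by omega)]; decide

lemma V_kron (j s t k : ℤ) : (V j s t k : M n) = kron fun i =>
    (if i = site n j then sz else 1) * xp (kap s i + kap t i) * (if i = site n k then sz else 1) := by
  simp only [V, zs, pauliAt, U, fx, kron_mul, Pi.add_apply]

lemma xp0 : xp 0 = 1 := by simp [xp]
lemma xp1 : xp 1 = sx := by simp [xp]
lemma xp2 : xp (1 + 1) = 1 := by rw [z2_self, xp0]

lemma Z_eq (j : ℕ) (hj : j + 2 ≤ n) : Z n j = Complex.I • A ((j : ℤ) + 1) := by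
  have h : str n sz sz j = S 0 (0 + ((j : ℤ) + 1)) := by
    have e1 : (0 : ℤ) + 1 = (1 : ℕ) := by norm_num
    have e0 : (0 : ℤ) = (0 : ℕ) := by norm_num
    have e2 : (0 : ℤ) + ((j : ℤ) + 1) = (j + 1 : ℕ) := by push_cast; ring
    rw [S, e2, V_kron, e1, e0, str]
    congr 1; funext i
    simp only [eq_site_iff i 0 (by omega), eq_site_iff i (j + 1) (by omega),
      kap_val 1 (by omega) i, kap_val (j + 1) (by omega) i]
    split_ifs <;> first | omega | simp [xp0, xp1, xp2]
  rw [Z, h, symmC_S]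

lemma sx_sz_I : sx * sz = Complex.I • sy := by
  ext i j; fin_cases i <;> fin_cases j <;> simp [sz, sx, sy, Matrix.mul_apply]

lemma sz_sx_I : sz * sx = (-Complex.I) • sy := by
  ext i j; fin_cases i <;> fin_cases j <;> simp [sz, sx, sy, Matrix.mul_apply]

lemma Y_eq (j : ℕ) (hj : j + 2 ≤ n) : Y n j = Complex.I • A (-((j : ℤ) + 1)) := by
  have h : str n sy sy j = S ((j : ℤ) + 1) (((j : ℤ) + 1) + -((j : ℤ) + 1)) := by
    have e0 : ((j : ℤ) + 1) + -((j : ℤ) + 1) = (0 : ℕ) := by push_cast; ring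
    have e1 : (j : ℤ) + 1 + 1 = (j + 2 : ℕ) := by push_cast; ring
    have e2 : (j : ℤ) + 1 = (j + 1 : ℕ) := by push_cast; ring
    rw [S, e0, e1, e2, V_kron, str]
    set g : Fin n → Matrix (Fin 2) (Fin 2) ℂ := fun i => if (i : ℕ) = 0 then sy else
      if (i : ℕ) = j + 1 then sz * sx else if (i : ℕ) ≤ j then sx else 1 with hg
    symm
    rw [kron_smul_single _ g Complex.I (site n (0 : ℕ)),
      kron_smul_single g (fun i => if (i : ℕ) = 0 then sy else if (i : ℕ) = j + 1 then sy
        else if (i : ℕ) ≤ j then sx else 1) (-Complex.I) (site n (j + 1 : ℕ)), smul_smul]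
    · simp
    · intro i
      simp only [hg, eq_site_iff i (j + 1) (by omega)]
      split_ifs <;> first | omega | simp [sz_sx_I]
    · intro i
      simp only [hg, eq_site_iff i 0 (by omega), eq_site_iff i (j + 1) (by omega),
        kap_val 0 (by omega) i, kap_val (j + 2) (by omega) i]
      split_ifs <;> first | omega | simp [xp0, xp1, xp2, sx_sz_I]
  rw [Y, h, symmC_S]

lemma X_eq : - X n = Complex.I • A 0 := by
  have hn : 0 < n := Nat.pos_of_ne_zero (NeZero.ne n)
  have h : (S 0 (0 + 0) : M n) =
      (-1 : ℂ) • (kron fun i : Fin n => if (i : ℕ) = 0 then sx else 1) := by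
    have e1 : (0 : ℤ) + 1 = (1 : ℕ) := by norm_num
    have e0 : (0 : ℤ) = (0 : ℕ) := by norm_num
    rw [S, add_zero, V_kron, e1, e0]
    apply kron_smul_single _ _ _ (site n (0 : ℕ))
    intro i
    simp only [eq_site_iff i 0 hn, kap_val 1 (by omega) i, kap_val 0 (by omega) i]
    have : sz * sx * sz = - sx := by rw [mul_assoc, sx_sz, mul_neg, ← mul_assoc, sz_sq, one_mul]
    split_ifs <;> first | omega | simp [xp0, xp1, xp2, this]
  have h2 := symmC_S (n := n) 0 0
  rw [h, symmC_smul] at h2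
  rw [X, ← h2]; simp

lemma XX_eq : XX n = Complex.I • A n := by
  have hn : 0 < n := Nat.pos_of_ne_zero (NeZero.ne n)
  have h : (S (-1) (-1 + n) : M n) =
      (kron fun i : Fin n => if (i : ℕ) = n - 1 then 1 else sx) := by
    have e1 : (-1 : ℤ) + 1 = (0 : ℕ) := by norm_num
    have e0 : (-1 : ℤ) + n = (n - 1 : ℕ) := by omega
    have e2 : site n (-1) = site n (n - 1 : ℕ) := by
      rw [← e0, site_add_n]
    rw [S, e1, e0, V_kron, e2]
    congr 1; funext i
    have := i.2
    simp only [eq_site_iff i (n - 1) (by omega), kap_val (n - 1) (by omega) i,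
      kap_val 0 (by omega) i]
    split_ifs <;> first | omega | simp [xp0, xp1, xp2, sz_sq]
  rw [XX, ← h, symmC_S]

lemma A_zero : (A 0 : M n) = - H1 n := by
  rw [A, H1, Finset.sum_range, ← Finset.sum_neg_distrib]
  refine Finset.sum_congr rfl fun i _ => ?_
  rw [add_zero, S, V, ← xs_U, U_self, mul_one, xs_eq, site_coe, mul_assoc, (H1_zs i).2, mul_neg,
    ← mul_assoc, zs_sq, one_mul]

lemma A_one : (A 1 : M n) = H0 n := by
  rw [A, H0, Finset.sum_range]
  refine Finset.sum_congr rfl fun i _ => ?_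
  rw [S, V, U_self, mul_one, ← rot_site, site_coe]; rfl

lemma sum_split {T : Type*} [AddCommGroup T] (f : ℤ → T) (hf : ∀ j, f (j + 2 * n) = f j) :
    ∑ i ∈ Finset.range (2 * n), f i = f 0 + f n +
      ∑ k ∈ Finset.range (n - 1), (f (k + 1) + f (-(k + 1))) := by
  obtain ⟨p, rfl⟩ : ∃ p, n = p + 1 := ⟨n - 1, by have := NeZero.ne n; omega⟩
  have e : 2 * (p + 1) = (p + 1) + (p + 1) := by ring
  rw [e, Finset.sum_range_add, Finset.sum_range_succ', Finset.sum_range_succ',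
    Finset.sum_add_distrib, add_tsub_cancel_right]
  have : ∑ k ∈ Finset.range p, f (-((k : ℤ) + 1)) =
      ∑ k ∈ Finset.range p, f (((p + 1 + (k + 1) : ℕ)) : ℤ) := by
    rw [← Finset.sum_range_reflect]
    refine Finset.sum_congr rfl fun k hk => ?_
    rw [Finset.mem_range] at hk
    rw [← hf]; congr 1; push_cast; omega
  rw [this]
  push_cast
  simp only [add_zero]
  abel

/-! ### The dynamical Lie algebra -/

lemma lie_H1_A (m : ℤ) : ⁅Complex.I • H1 n, Complex.I • (A m : M n)⁆ = (2 : ℝ) • D m := by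
  have h := H1_A (n := n) m
  rw [Ring.lie_def, smul_mul_smul_comm, smul_mul_smul_comm, ← smul_sub, h, Complex.I_mul_I]
  ext x y; simp

lemma lie_H1_D (m : ℤ) : ⁅Complex.I • H1 n, (D m : M n)⁆ =
    (-4 : ℝ) • (Complex.I • A m - Complex.I • A (-m)) := by
  have h := H1_D (n := n) m
  rw [Ring.lie_def, smul_mul_assoc, mul_smul_comm, ← smul_sub, h]
  ext x y; simp; ring

lemma lie_H0_A (hn : 3 ≤ n) (m : ℤ) :
    ⁅Complex.I • H0 n, Complex.I • (A m : M n)⁆ = (-2 : ℝ) • D (m - 1) := by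
  have h := H0_A hn m
  rw [Ring.lie_def, smul_mul_smul_comm, smul_mul_smul_comm, ← smul_sub, h, Complex.I_mul_I]
  ext x y; simp

lemma lie_H0_D (hn : 3 ≤ n) (m : ℤ) : ⁅Complex.I • H0 n, (D m : M n)⁆ =
    (4 : ℝ) • (Complex.I • A (m + 1) - Complex.I • A (1 - m)) := by
  have h := H0_D hn m
  rw [Ring.lie_def, smul_mul_assoc, mul_smul_comm, ← smul_sub, h]
  ext x y; simp; ring

lemma lie_rsmul (H B : M n) (c : ℝ) : ⁅H, c • B⁆ = c • ⁅H, B⁆ := lie_smul c H B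

lemma per_emod {T : Type*} (f : ℤ → T) (hf : ∀ j, f (j + 2 * n) = f j) (m : ℤ) :
    f m = f (m % (2 * n : ℕ)) := by
  have hp : Function.Periodic f (2 * n : ℤ) := hf
  have h := hp.sub_zsmul_eq (m / (2 * n : ℤ)) (x := m)
  rw [← h]; congr 1
  rw [Int.emod_def]; push_cast; rw [smul_eq_mul]; ring

/-- the candidate space -/
def W (n : ℕ) [NeZero n] : Submodule ℝ (M n) :=
  Submodule.span ℝ (Set.range fun m : Fin (2 * n) => Complex.I • (A ((m : ℕ) : ℤ) : M n)) ⊔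
  Submodule.span ℝ (Set.range fun k : Fin (n - 1) => (D (((k : ℕ) : ℤ) + 1) : M n))

lemma A_mem_W (m : ℤ) : Complex.I • (A m : M n) ∈ W n := by
  apply Submodule.mem_sup_left
  apply Submodule.subset_span
  have h0 : (0 : ℤ) < n := npos
  rw [per_emod (n := n) A A_2n m]
  have h1 := Int.emod_nonneg m (b := (2 * n : ℕ)) (by omega)
  have h2 := Int.emod_lt_of_pos m (b := (2 * n : ℕ)) (by omega)
  refine ⟨⟨(m % (2 * n : ℕ)).toNat, by omega⟩, ?_⟩
  simp only
  congr 2; omega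

lemma D_mem_W (m : ℤ) : (D m : M n) ∈ W n := by
  have h0 : (0 : ℤ) < n := npos
  have key : ∀ k : ℕ, 1 ≤ k → k < n → (D (k : ℤ) : M n) ∈ W n := by
    intro k h1 h2
    apply Submodule.mem_sup_right
    apply Submodule.subset_span
    refine ⟨⟨k - 1, by omega⟩, ?_⟩
    simp only
    congr 1; omega
  rw [per_emod (n := n) D D_2n m]
  have h1 := Int.emod_nonneg m (b := (2 * n : ℕ)) (by omega)
  have h2 := Int.emod_lt_of_pos m (b := (2 * n : ℕ)) (by omega)
  obtain ⟨r, hr⟩ := Int.eq_ofNat_of_zero_le h1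
  rw [hr] at h2 ⊢
  by_cases c0 : r = 0
  · subst c0; rw [Nat.cast_zero, D_zero]; exact Submodule.zero_mem _
  by_cases c1 : r = n
  · subst c1; rw [D_n]; exact Submodule.zero_mem _
  by_cases c2 : r < n
  · exact key r (by omega) c2
  · have : (D (r : ℤ) : M n) = - D ((2 * n - r : ℕ) : ℤ) := by
      rw [← D_neg, ← D_2n (-((2 * n - r : ℕ) : ℤ))]; congr 1; omega
    rw [this]
    exact Submodule.neg_mem _ (key _ (by omega) (by omega))

lemma W_stable (H : M n) (h1 : ∀ m : ℤ, ⁅H, Complex.I • (A m : M n)⁆ ∈ W n)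
    (h2 : ∀ m : ℤ, ⁅H, (D m : M n)⁆ ∈ W n) : ∀ C ∈ W n, ⁅H, C⁆ ∈ W n := by
  have : W n ≤ (W n).comap (LinearMap.mulLeft ℝ H - LinearMap.mulRight ℝ H) := by
    apply sup_le
    · rw [Submodule.span_le]
      rintro _ ⟨m, rfl⟩
      exact h1 _
    · rw [Submodule.span_le]
      rintro _ ⟨m, rfl⟩
      exact h2 _
  intro C hC
  exact this hC

lemma DLA_le_W (hn : 3 ≤ n) : ∀ B ∈ DLA n, B ∈ W n := by
  let L : LieSubalgebra ℝ (M n) :=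
    { carrier := {B | B ∈ W n ∧ ∀ C ∈ W n, ⁅B, C⁆ ∈ W n}
      add_mem' := by
        rintro a b ⟨ha, ha'⟩ ⟨hb, hb'⟩
        refine ⟨Submodule.add_mem _ ha hb, fun C hC => ?_⟩
        rw [add_lie]; exact Submodule.add_mem _ (ha' C hC) (hb' C hC)
      zero_mem' := ⟨Submodule.zero_mem _, fun C _ => by rw [zero_lie]; exact Submodule.zero_mem _⟩
      smul_mem' := by
        rintro c a ⟨ha, ha'⟩
        refine ⟨Submodule.smul_mem _ c ha, fun C hC => ?_⟩
        rw [smul_lie]; exact Submodule.smul_mem _ _ (ha' C hC)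
      lie_mem' := by
        rintro a b ⟨ha, ha'⟩ ⟨hb, hb'⟩
        refine ⟨ha' b hb, fun C hC => ?_⟩
        rw [lie_lie]
        exact Submodule.sub_mem _ (ha' _ (hb' C hC)) (hb' _ (ha' C hC)) }
  have hL : DLA n ≤ L := by
    apply LieSubalgebra.lieSpan_le.2
    rintro B (rfl | rfl)
    · refine ⟨by rw [← A_one]; exact A_mem_W 1, W_stable _ (fun m => ?_) (fun m => ?_)⟩
      · rw [lie_H0_A hn]; exact Submodule.smul_mem _ _ (D_mem_W _)
      · rw [lie_H0_D hn]
        exact Submodule.smul_mem _ _ (Submodule.sub_mem _ (A_mem_W _) (A_mem_W _))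
    · refine ⟨?_, W_stable _ (fun m => ?_) (fun m => ?_)⟩
      · have := Submodule.neg_mem _ (A_mem_W (n := n) 0)
        rwa [A_zero, smul_neg, neg_neg] at this
      · rw [lie_H1_A]; exact Submodule.smul_mem _ _ (D_mem_W _)
      · rw [lie_H1_D]
        exact Submodule.smul_mem _ _ (Submodule.sub_mem _ (A_mem_W _) (A_mem_W _))
  exact fun B hB => (hL hB).1

lemma H0_mem : Complex.I • H0 n ∈ DLA n := LieSubalgebra.subset_lieSpan (by simp)
lemma H1_mem : Complex.I • H1 n ∈ DLA n := LieSubalgebra.subset_lieSpan (by simp)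

lemma A_mem_aux (hn : 3 ≤ n) (k : ℕ) :
    Complex.I • (A (k : ℤ) : M n) ∈ DLA n ∧ Complex.I • (A (1 - (k : ℤ)) : M n) ∈ DLA n := by
  have unsm : ∀ (c : ℝ) (B : M n), c ≠ 0 → c • B ∈ DLA n → B ∈ DLA n := by
    intro c B hc h
    have := (DLA n).smul_mem c⁻¹ h
    rwa [smul_smul, inv_mul_cancel₀ hc, one_smul] at this
  induction k with
  | zero =>
    constructor
    · rw [Nat.cast_zero, A_zero, smul_neg]; exact (DLA n).neg_mem H1_mem
    · rw [Nat.cast_zero, sub_zero, A_one]; exact H0_mem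
  | succ k ih =>
    have hD : (D (k : ℤ) : M n) ∈ DLA n := by
      apply unsm 2 _ (by norm_num)
      rw [← lie_H1_A]; exact (DLA n).lie_mem H1_mem ih.1
    have h1 := (DLA n).lie_mem H1_mem hD
    have h0 := (DLA n).lie_mem H0_mem hD
    rw [lie_H1_D] at h1
    rw [lie_H0_D hn] at h0
    have h1' := unsm _ _ (by norm_num) h1
    have h0' := unsm _ _ (by norm_num) h0
    constructor
    · have := (DLA n).add_mem h0' ih.2
      rw [sub_add_cancel] at this
      exact_mod_cast this
    · have := (DLA n).sub_mem ih.1 h1'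
      rw [sub_sub_cancel] at this
      have e : (1 : ℤ) - ((k + 1 : ℕ) : ℤ) = -k := by push_cast; ring
      rw [e]; exact this

/-! ### Central elements -/

/-- weights depending on the parity only -/
def w (c0 c1 : ℝ) (m : ℤ) : ℝ := if Even m then c0 else c1

lemma w_add_two (c0 c1 : ℝ) (m : ℤ) : w c0 c1 (m + 2 * n) = w c0 c1 m := by
  simp [w, Int.even_add]

lemma w_neg (c0 c1 : ℝ) (m : ℤ) : w c0 c1 (-m) = w c0 c1 m := by simp [w]

/-- the central elements -/
def CC (c0 c1 : ℝ) : M n := ∑ m ∈ Finset.range (2 * n), w c0 c1 m • (Complex.I • A (m : ℤ))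

lemma CC_mem (hn : 3 ≤ n) (c0 c1 : ℝ) : CC c0 c1 ∈ DLA n :=
  (DLA n).toSubmodule.sum_mem fun m _ => (DLA n).smul_mem _ (A_mem_aux hn m).1

lemma CC_split (c0 c1 : ℝ) : (CC c0 c1 : M n) = w c0 c1 0 • (-X n) + w c0 c1 n • XX n +
    ∑ k ∈ Finset.range (n - 1), w c0 c1 (k + 1) • (Y n k + Z n k) := by
  rw [CC, sum_split (n := n) (fun m => w c0 c1 m • (Complex.I • (A m : M n)))
    (fun j => by simp only [w_add_two, A_2n]), X_eq, XX_eq]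
  congr 1
  refine Finset.sum_congr rfl fun k hk => ?_
  rw [Finset.mem_range] at hk
  rw [Y_eq k (by omega), Z_eq k (by omega), w_neg, smul_add, add_comm]

lemma C1_eq (hodd : Odd n) : C1odd n = CC 1 0 := by
  have hn : ¬ Even (n : ℤ) := by rw [Int.not_even_iff_odd]; exact_mod_cast hodd
  rw [CC_split, C1odd]
  have h : w 1 0 (n : ℤ) = 0 := if_neg hn
  have h0 : w 1 0 0 = 1 := if_pos (by simp)
  rw [h, h0, zero_smul, one_smul, add_zero]
  congr 1
  refine Finset.sum_congr rfl fun k hk => ?_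
  by_cases hk : Odd k
  · have : w 1 0 ((k : ℤ) + 1) = 1 := if_pos (by exact_mod_cast hk.add_one)
    rw [if_pos hk, this, one_smul]
  · have : w 1 0 ((k : ℤ) + 1) = 0 := if_neg (by
      rw [Int.even_add_one, not_not]; exact_mod_cast Nat.not_odd_iff_even.1 hk)
    rw [if_neg hk, this, zero_smul]

lemma C2_eq (hodd : Odd n) : C2odd n = CC 0 1 := by
  have hn : ¬ Even (n : ℤ) := by rw [Int.not_even_iff_odd]; exact_mod_cast hodd
  rw [CC_split, C2odd]
  have h : w 0 1 (n : ℤ) = 1 := if_neg hn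
  have h0 : w 0 1 0 = 0 := if_pos (by simp)
  rw [h, h0, zero_smul, one_smul, zero_add]
  congr 1
  refine Finset.sum_congr rfl fun k hk => ?_
  by_cases hk : Odd k
  · have : w 0 1 ((k : ℤ) + 1) = 0 := if_pos (by exact_mod_cast hk.add_one)
    rw [if_neg (Nat.not_even_iff_odd.2 hk), this, zero_smul]
  · have : w 0 1 ((k : ℤ) + 1) = 1 := if_neg (by
      rw [Int.even_add_one, not_not]; exact_mod_cast Nat.not_odd_iff_even.1 hk)
    rw [if_pos (Nat.not_odd_iff_even.1 hk), this, one_smul]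

lemma CC_lin (c0 c1 : ℝ) : c0 • (CC 1 0 : M n) + c1 • CC 0 1 = CC c0 c1 := by
  simp only [CC, Finset.smul_sum, ← Finset.sum_add_distrib, smul_smul c0, smul_smul c1,
    ← add_smul]
  refine Finset.sum_congr rfl fun k hk => ?_
  congr 1
  simp only [w]; split_ifs <;> simp

lemma odd_sum {T : Type*} [AddCommGroup T] (f : ℤ → T) (hf : ∀ j, f (j + 2 * n) = f j)
    (hneg : ∀ j, f (-j) = - f j) (h0 : f 0 = 0) (hn : f n = 0) :
    ∑ i ∈ Finset.range (2 * n), f i = 0 := by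
  rw [sum_split (n := n) f hf, h0, hn]
  simp only [hneg, add_neg_cancel, Finset.sum_const_zero, add_zero]

lemma CC_H1 (c0 c1 : ℝ) : ⁅Complex.I • H1 n, (CC c0 c1 : M n)⁆ = 0 := by
  rw [CC, lie_sum]
  simp only [lie_rsmul, lie_H1_A]
  refine odd_sum (n := n) (fun m : ℤ => w c0 c1 m • (2 : ℝ) • (D m : M n)) ?_ ?_ ?_ ?_
  · intro j; simp only [w_add_two, D_2n]
  · intro j; simp only [w_neg, D_neg, smul_neg]
  · simp [D_zero]
  · simp [D_n]

lemma CC_H0 (hn : 3 ≤ n) (c0 c1 : ℝ) : ⁅Complex.I • H0 n, (CC c0 c1 : M n)⁆ = 0 := by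
  rw [CC, lie_sum]
  simp only [lie_rsmul, lie_H0_A hn]
  have hw : ∀ j, w c0 c1 (j + 2 * n + 1) = w c0 c1 (j + 1) := fun j => by
    rw [add_right_comm, w_add_two]
  have hw' : ∀ j, w c0 c1 (-j + 1) = w c0 c1 (j + 1) := fun j => by
    simp [w, Int.even_add_one]
  have key := odd_sum (n := n) (fun m : ℤ => w c0 c1 (m + 1) • (-2 : ℝ) • (D m : M n))
    (fun j => by simp only [hw, D_2n]) (fun j => by simp only [hw', D_neg, smul_neg])
    (by simp [D_zero]) (by simp [D_n])
  rw [← key, ← sum_shift (fun m : ℤ => w c0 c1 (m + 1) • (-2 : ℝ) • (D m : M n)) (2 * n)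
    (fun j => by push_cast; simp only [hw, D_2n]) (-1)]
  refine Finset.sum_congr rfl fun i _ => ?_
  simp [sub_eq_add_neg]

lemma central (E : M n) (h0 : ⁅Complex.I • H0 n, E⁆ = 0) (h1 : ⁅Complex.I • H1 n, E⁆ = 0) :
    ∀ B ∈ DLA n, ⁅E, B⁆ = 0 := by
  let L : LieSubalgebra ℝ (M n) :=
    { carrier := {B | ⁅E, B⁆ = 0}
      add_mem' := by
        intro a b (ha : ⁅E, a⁆ = 0) (hb : ⁅E, b⁆ = 0)
        change ⁅E, a + b⁆ = 0
        rw [lie_add, ha, hb, add_zero]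
      zero_mem' := lie_zero E
      smul_mem' := by
        intro c a (ha : ⁅E, a⁆ = 0)
        change ⁅E, c • a⁆ = 0
        rw [lie_smul, ha, smul_zero]
      lie_mem' := by
        intro a b (ha : ⁅E, a⁆ = 0) (hb : ⁅E, b⁆ = 0)
        change ⁅E, ⁅a, b⁆⁆ = 0
        rw [leibniz_lie, ha, hb, zero_lie, lie_zero, add_zero] }
  have hL : DLA n ≤ L := by
    apply LieSubalgebra.lieSpan_le.2
    rintro B (rfl | rfl)
    · change ⁅E, _⁆ = 0
      rw [← lie_skew, h0, neg_zero]
    · change ⁅E, _⁆ = 0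
      rw [← lie_skew, h1, neg_zero]
  exact fun B hB => hL hB

lemma F_smul_real (r : ℕ) (c : ℝ) (B : M n) : F r (c • B) = (c : ℂ) * F r B := by
  have : c • B = (c : ℂ) • B := by ext x y; simp
  rw [this, map_smul, smul_eq_mul]

/-- symmetry of coefficient functions -/
lemma coef_symm (b : ℤ → ℝ) (hb : ∀ j, b (j + 2 * n) = b j)
    (h : ∀ r : ℕ, 1 ≤ r → r < n →
      (∑ m ∈ Finset.range (2 * n), (b m : ℂ) * F r (D (m : ℤ) : M n)) = 0) (m : ℤ) :
    b (-m) = b m := by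
  have hpos : (0 : ℤ) < n := npos
  have key : ∀ r : ℕ, 1 ≤ r → r < n → b (-(r : ℤ)) = b r := by
    intro r h1 h2
    have hs := h r h1 h2
    rw [sum_split (n := n) (fun m => (b m : ℂ) * F r (D m : M n))
      (fun j => by simp only [hb, D_2n])] at hs
    simp only [D_zero, D_n, map_zero, mul_zero, zero_add, D_neg, map_neg] at hs
    rw [Finset.sum_eq_single (r - 1)] at hs
    · have e : (((r - 1 : ℕ) : ℤ) + 1) = (r : ℤ) := by omega
      rw [e, F_D r r h1 h2, if_pos rfl] at hs
      have hn0 : (n : ℂ) ≠ 0 := by exact_mod_cast NeZero.ne n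
      have h3 : ((b (-(r : ℤ)) : ℂ) - b r) * (2 * n) = 0 := by linear_combination hs
      rcases mul_eq_zero.1 h3 with h4 | h4
      · exact_mod_cast sub_eq_zero.1 h4
      · exfalso; apply hn0; linear_combination h4 / 2
    · intro k hk hkr
      rw [Finset.mem_range] at hk
      have := F_D (n := n) r (k + 1) (by omega) (by omega)
      rw [if_neg (by omega)] at this
      push_cast at this
      rw [this]; simp
    · intro hh
      exfalso; apply hh; rw [Finset.mem_range]; omega
  have h1 := Int.emod_nonneg m (b := (2 * n : ℕ)) (by omega)
  have h2 := Int.emod_lt_of_pos m (b := (2 * n : ℕ)) (by omega)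
  rw [per_emod (n := n) b hb m, per_emod (n := n) (fun m => b (-m))
    (fun j => by rw [← hb (-(j + 2 * n))]; congr 1; ring) m]
  obtain ⟨r, hr⟩ := Int.eq_ofNat_of_zero_le h1
  simp only [hr]
  rw [hr] at h2
  by_cases c0 : r = 0
  · subst c0; simp
  by_cases c1 : r = n
  · subst c1; rw [← hb]; congr 1; ring
  by_cases c2 : r < n
  · exact key r (by omega) c2
  · have k := key (2 * n - r) (by omega) (by omega)
    have e1 : b (-(r : ℤ)) = b ((2 * n - r : ℕ) : ℤ) := by
      rw [← hb]; congr 1; omega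
    have e2 : b (r : ℤ) = b (-((2 * n - r : ℕ) : ℤ)) := by
      rw [← hb (-_)]; congr 1; omega
    rw [e1, e2, k]

lemma center_sub (hn : 3 ≤ n) (E : M n) (hE : E ∈ W n) (h0 : ⁅Complex.I • H0 n, E⁆ = 0)
    (h1 : ⁅Complex.I • H1 n, E⁆ = 0) : ∃ c0 c1 : ℝ, E = CC c0 c1 := by
  have hpos : (0 : ℤ) < n := npos
  have hn0 : (n : ℂ) ≠ 0 := by exact_mod_cast NeZero.ne n
  obtain ⟨E1, hE1, E2, hE2, rfl⟩ := Submodule.mem_sup.1 hE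
  obtain ⟨a, rfl⟩ := (Submodule.mem_span_range_iff_exists_fun ℝ).1 hE1
  obtain ⟨g, rfl⟩ := (Submodule.mem_span_range_iff_exists_fun ℝ).1 hE2
  -- periodic extension of `a`, extension by zero of `g`
  let b : ℤ → ℝ := fun m => a ⟨(m % (2 * n : ℕ)).toNat, by
    have h1 := Int.emod_nonneg m (b := (2 * n : ℕ)) (by omega)
    have h2 := Int.emod_lt_of_pos m (b := (2 * n : ℕ)) (by omega)
    omega⟩
  let g' : ℕ → ℝ := fun k => if h : k < n - 1 then g ⟨k, h⟩ else 0
  have hb : ∀ j, b (j + 2 * n) = b j := by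
    intro j
    have : (j + 2 * n) % ((2 * n : ℕ) : ℤ) = j % ((2 * n : ℕ) : ℤ) := by push_cast; simp
    simp only [b, this]
  have ea : ∑ m : Fin (2 * n), a m • Complex.I • (A ((m : ℕ) : ℤ) : M n) =
      ∑ m ∈ Finset.range (2 * n), b m • Complex.I • (A (m : ℤ) : M n) := by
    rw [Finset.sum_range]
    refine Finset.sum_congr rfl fun m _ => ?_
    congr 1
    simp only [b]; congr 1; apply Fin.ext; simp only
    rw [Int.emod_eq_of_lt (by omega) (by have := m.2; omega)]; simp
  have eg : ∑ k : Fin (n - 1), g k • (D (((k : ℕ) : ℤ) + 1) : M n) =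
      ∑ k ∈ Finset.range (n - 1), g' k • (D ((k : ℤ) + 1) : M n) := by
    rw [Finset.sum_range]
    refine Finset.sum_congr rfl fun k _ => ?_
    congr 1
    simp only [g', k.2, dif_pos]
  simp only [ea, eg] at h0 h1 ⊢
  -- real combinations
  have rD : ∀ (r : ℕ) (m : ℤ), (F r (D m : M n)).im = 0 := by
    intro r m
    have key : ∀ k : ℕ, 1 ≤ k → k < n → (F r (D (k : ℤ) : M n)).im = 0 := by
      intro k h1 h2
      rw [F_D r k h1 h2]; split_ifs <;> simp
    rw [per_emod (n := n) D D_2n m]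
    have h1 := Int.emod_nonneg m (b := (2 * n : ℕ)) (by omega)
    have h2 := Int.emod_lt_of_pos m (b := (2 * n : ℕ)) (by omega)
    obtain ⟨s, hs⟩ := Int.eq_ofNat_of_zero_le h1
    rw [hs] at h2 ⊢
    by_cases c0 : s = 0
    · subst c0; simp [D_zero]
    by_cases c1 : s = n
    · subst c1; simp [D_n]
    by_cases c2 : s < n
    · exact key s (by omega) c2
    · have : (D (s : ℤ) : M n) = - D ((2 * n - s : ℕ) : ℤ) := by
        rw [← D_neg, ← D_2n (-((2 * n - s : ℕ) : ℤ))]; congr 1; omega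
      rw [this, map_neg, Complex.neg_im, key _ (by omega) (by omega), neg_zero]
  rw [lie_add, lie_sum, lie_sum] at h0 h1
  simp only [lie_rsmul, lie_H1_A, lie_H1_D] at h1
  simp only [lie_rsmul, lie_H0_A hn, lie_H0_D hn] at h0
  have f1 : ∀ r, (∑ m ∈ Finset.range (2 * n), (b m : ℂ) * (2 * F r (D (m : ℤ) : M n))) +
      ∑ k ∈ Finset.range (n - 1), (g' k : ℂ) * (-4 * (Complex.I * F r (A ((k : ℤ) + 1) : M n) -
        Complex.I * F r (A (-((k : ℤ) + 1)) : M n))) = 0 := by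
    intro r
    have := congrArg (F r) h1
    simpa only [map_add, map_sum, map_sub, F_smul_real, map_smul, smul_eq_mul, map_zero,
      Complex.ofReal_neg, Complex.ofReal_ofNat] using this
  -- the values of `F` on differences of `A`
  have vA : ∀ r k : ℕ, k < n - 1 → F r (A ((k : ℤ) + 1) : M n) - F r (A (-((k : ℤ) + 1)) : M n) =
      ((((if k = r then (n : ℝ) else 0) + if r = k + 2 then (n : ℝ) else 0) : ℝ) : ℂ) := by
    intro r k hk
    have e1 := F_A_pos (n := n) r (k + 1) (by omega) (by omega)
    have e2 := F_A_neg (n := n) r (k + 1) (by omega)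
    push_cast at e1 e2
    rw [e1, e2]
    push_cast
    split_ifs <;> first | omega | simp
  have f1im : ∀ r : ℕ, ∑ k ∈ Finset.range (n - 1), g' k * ((if k = r then (n : ℝ) else 0) +
      if r = k + 2 then (n : ℝ) else 0) = 0 := by
    intro r
    have h := congrArg Complex.im (f1 r)
    rw [Complex.add_im, Complex.im_sum, Complex.im_sum, Finset.sum_eq_zero, zero_add] at h
    · rw [Complex.zero_im] at h
      have : ∀ k ∈ Finset.range (n - 1),
          ((g' k : ℂ) * (-4 * (Complex.I * F r (A ((k : ℤ) + 1) : M n) -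
            Complex.I * F r (A (-((k : ℤ) + 1)) : M n)))).im =
          -4 * (g' k * ((if k = r then (n : ℝ) else 0) + if r = k + 2 then (n : ℝ) else 0)) := by
        intro k hk
        rw [← mul_sub, vA r k (Finset.mem_range.1 hk), Complex.im_ofReal_mul]
        have : (-4 : ℂ) = ((-4 : ℝ) : ℂ) := by simp
        rw [this, Complex.im_ofReal_mul, mul_comm Complex.I, Complex.im_ofReal_mul, Complex.I_im]
        ring
      rw [Finset.sum_congr rfl this, ← Finset.mul_sum] at h
      linarith
    · intro m _
      have : (2 : ℂ) = ((2 : ℝ) : ℂ) := by simp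
      rw [Complex.im_ofReal_mul, this, Complex.im_ofReal_mul, rD]; simp
  have hnR : (n : ℝ) ≠ 0 := by exact_mod_cast NeZero.ne n
  have gz : ∀ k, g' k = 0 := by
    intro k
    induction k using Nat.strong_induction_on with
    | _ k ih =>
      by_cases hk : k < n - 1
      · have h := f1im k
        rw [Finset.sum_eq_single k] at h
        · simpa [hnR] using h
        · intro l hl hlk
          by_cases h2 : k = l + 2
          · rw [ih l (by omega), zero_mul]
          · simp [hlk, h2]
        · intro hh; exact absurd (Finset.mem_range.2 hk) hh
      · simp only [g', dif_neg hk]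
  simp only [gz, zero_smul, Finset.sum_const_zero, add_zero] at h0 h1 ⊢
  have s1 : ∀ m, b (-m) = b m := by
    apply coef_symm b hb
    intro r _ _
    have := congrArg (F r) h1
    simp only [map_sum, F_smul_real, map_zero, Complex.ofReal_ofNat] at this
    have h2 : (2 : ℂ) * ∑ m ∈ Finset.range (2 * n), (b m : ℂ) * F r (D (m : ℤ) : M n) = 0 := by
      rw [← this, Finset.mul_sum]
      refine Finset.sum_congr rfl fun m _ => ?_
      ring
    simpa using h2
  have s2 : ∀ m, b (-m + 1) = b (m + 1) := by
    have hb' : ∀ j, b (j + 2 * n + 1) = b (j + 1) := fun j => by rw [add_right_comm, hb]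
    apply coef_symm (fun m => b (m + 1)) hb'
    intro r _ _
    have := congrArg (F r) h0
    simp only [map_sum, F_smul_real, map_zero, Complex.ofReal_ofNat, Complex.ofReal_neg] at this
    have h2 : (-2 : ℂ) * ∑ m ∈ Finset.range (2 * n),
        (b ((m : ℤ) + 1) : ℂ) * F r (D (m : ℤ) : M n) = 0 := by
      rw [← sum_shift (fun m : ℤ => (b (m + 1) : ℂ) * F r (D m : M n)) (2 * n)
        (fun j => by push_cast; simp only [hb', D_2n]) (-1)]
      rw [← this, Finset.mul_sum]
      refine Finset.sum_congr rfl fun m _ => ?_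
      rw [neg_add_cancel_right, ← sub_eq_add_neg]
      ring
    simpa using h2
  have s3 : Function.Periodic b 2 := by
    intro m
    have h1 := s2 (m + 1)
    have h2 := s1 m
    rw [show -(m + 1) + 1 = -m by ring, show m + 1 + 1 = m + 2 by ring] at h1
    rw [← h1, h2]
  refine ⟨b 0, b 1, ?_⟩
  rw [CC]
  refine Finset.sum_congr rfl fun m _ => ?_
  congr 1
  simp only [w]
  split_ifs with hm
  · obtain ⟨q, hq⟩ := hm
    have := s3.zsmul_eq q
    rw [smul_eq_mul] at this
    rw [hq, ← this]; congr 1; ring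
  · rw [Int.not_even_iff_odd] at hm
    obtain ⟨q, hq⟩ := hm
    have := s3.zsmul q 1
    rw [smul_eq_mul] at this
    rw [hq, ← this]; congr 1; ring

lemma F_CC (r : ℕ) (c0 c1 : ℝ) : F r (CC c0 c1 : M n) = Complex.I *
    ((w c0 c1 0 : ℂ) * F r (A 0 : M n) + w c0 c1 n * F r (A n : M n) +
    ∑ k ∈ Finset.range (n - 1), (w c0 c1 (k + 1) : ℂ) *
      (F r (A ((k : ℤ) + 1) : M n) + F r (A (-((k : ℤ) + 1)) : M n))) := by
  rw [CC, sum_split (n := n) (fun m => w c0 c1 m • (Complex.I • (A m : M n)))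
    (fun j => by simp only [w_add_two, A_2n])]
  simp only [map_add, map_sum, F_smul_real, map_smul, smul_eq_mul, w_neg, mul_add, Finset.mul_sum]
  congr 1
  · ring
  · refine Finset.sum_congr rfl fun k _ => ?_
    ring

lemma CC_indep (hn : 3 ≤ n) (hodd : Odd n) (c0 c1 : ℝ) (h : (CC c0 c1 : M n) = 0) :
    c0 = 0 ∧ c1 = 0 := by
  have hnC : (n : ℂ) ≠ 0 := by exact_mod_cast NeZero.ne n
  have v0 : ∀ r : ℕ, F r (A 0 : M n) = if r = 1 then -(n : ℂ) else 0 := by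
    intro r
    have := F_A_neg (n := n) r 0 (by omega)
    simpa using this
  have vn : ∀ r : ℕ, F r (A n : M n) = if n = r + 1 then (n : ℂ) else 0 := fun r =>
    F_A_pos r n (by omega) le_rfl
  have vk : ∀ r k : ℕ, k < n - 1 → F r (A ((k : ℤ) + 1) : M n) + F r (A (-((k : ℤ) + 1)) : M n) =
      (if k = r then (n : ℂ) else 0) + if r = k + 2 then -(n : ℂ) else 0 := by
    intro r k hk
    have e1 := F_A_pos (n := n) r (k + 1) (by omega) (by omega)
    have e2 := F_A_neg (n := n) r (k + 1) (by omega)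
    push_cast at e1 e2
    rw [e1, e2]
  constructor
  · have hF := F_CC (n := n) n c0 c1
    rw [h, map_zero, v0, vn, if_neg (by omega), if_neg (by omega), Finset.sum_eq_single (n - 2),
      vk n (n - 2) (by omega), if_neg (by omega), if_pos (by omega)] at hF
    · have e : w c0 c1 (((n - 2 : ℕ) : ℤ) + 1) = c0 := by
        apply if_pos
        have : Even (n - 2 + 1) := by
          obtain ⟨q, hq⟩ := hodd
          exact ⟨q, by omega⟩
        exact_mod_cast this
      rw [e] at hF
      simpa [hnC] using hF
    · intro k hk hkn
      rw [Finset.mem_range] at hk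
      rw [vk n k hk, if_neg (by omega), if_neg (by omega)]; simp
    · intro hh; exfalso; apply hh; rw [Finset.mem_range]; omega
  · have hF := F_CC (n := n) 0 c0 c1
    rw [h, map_zero, v0, vn, if_neg (by omega), if_neg (by omega), Finset.sum_eq_single 0,
      vk 0 0 (by omega), if_pos rfl, if_neg (by omega)] at hF
    · have e : w c0 c1 (((0 : ℕ) : ℤ) + 1) = c1 := by
        apply if_neg; simp
      rw [e] at hF
      simpa [hnC] using hF
    · intro k hk hkn
      rw [Finset.mem_range] at hk
      rw [vk 0 k hk, if_neg (by omega), if_neg (by omega)]; simp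
    · intro hh; exfalso; apply hh; rw [Finset.mem_range]; omega

end

/-- For every odd `n ≥ 3`, the center of the dynamical Lie algebra
is the two-dimensional real span of `C1` and `C2`. -/
theorem stmt2 (n : ℕ) (hn : 3 ≤ n) (hodd : Odd n) :
    {A : M n | A ∈ DLA n ∧ ∀ B ∈ DLA n, ⁅A, B⁆ = 0} =
      (Submodule.span ℝ ({C1odd n, C2odd n} : Set (M n)) : Set (M n)) ∧
    Module.finrank ℝ (Submodule.span ℝ ({C1odd n, C2odd n} : Set (M n))) = 2 := by
  haveI : NeZero n := ⟨by omega⟩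
  rw [C1_eq hodd, C2_eq hodd]
  constructor
  · ext E
    simp only [Set.mem_setOf_eq, SetLike.mem_coe, Submodule.mem_span_pair]
    constructor
    · rintro ⟨hE, hc⟩
      have h0 : ⁅Complex.I • H0 n, E⁆ = 0 := by rw [← lie_skew, hc _ H0_mem, neg_zero]
      have h1 : ⁅Complex.I • H1 n, E⁆ = 0 := by rw [← lie_skew, hc _ H1_mem, neg_zero]
      obtain ⟨c0, c1, rfl⟩ := center_sub hn E (DLA_le_W hn E hE) h0 h1
      exact ⟨c0, c1, CC_lin c0 c1⟩
    · rintro ⟨c0, c1, rfl⟩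
      rw [CC_lin]
      exact ⟨CC_mem hn c0 c1, central _ (CC_H0 hn c0 c1) (CC_H1 c0 c1)⟩
  · have hli : LinearIndependent ℝ ![(CC 1 0 : M n), CC 0 1] := by
      rw [LinearIndependent.pair_iff]
      intro s t hst
      rw [CC_lin] at hst
      exact CC_indep hn hodd s t hst
    have := finrank_span_eq_card hli
    rw [Matrix.range_cons, Matrix.range_cons, Matrix.range_empty, Set.union_empty,
      Set.singleton_union] at this
    simpa using this

end
end Ising
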